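/- arXiv:1012.4221 — 4 statements merged into one kernel-verified Lean document; each statement's English description precedes it below -/
import Mathlib

section
/- Let m, n ≥ 1. The matrix (1/(mn)) I_{mn} lies in the intrinsic (relative) interior of the set S_{m,n} of separable states, and the affine span of S_{m,n} is the affine hyperplane {A ∈ H_{mn} : tr A = 1}; in particular, the dimension of S_{m,n} as a convex set equals (mn)² − 1. -/
open Matrix Kronecker ComplexOrder

/-- A density matrix: a positive semidefinite (Hermitian) matrix of trace one. -/
def IsDensityMatrix {m : ℕ} (A : Matrix (Fin m) (Fin m) ℂ) : Prop :=
  A.PosSemidef ∧ A.trace = 1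

/-- The set of bipartite separable states, the convex hull of Kronecker products of
density matrices. -/
noncomputable def SepStates (m n : ℕ) : Set (Matrix (Fin m × Fin n) (Fin m × Fin n) ℂ) :=
  convexHull ℝ {C | ∃ A B, IsDensityMatrix A ∧ IsDensityMatrix B ∧ C = A ⊗ₖ B}

/-- The cone generated by the separable states. -/
def InK {m n : ℕ} (A : Matrix (Fin m × Fin n) (Fin m × Fin n) ℂ) : Prop :=
  ∃ t : ℝ, 0 ≤ t ∧ ∃ s ∈ SepStates m n, A = t • s

theorem InK.smul {m n : ℕ} {A : Matrix (Fin m × Fin n) (Fin m × Fin n) ℂ} (hA : InK A)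
    {c : ℝ} (hc : 0 ≤ c) : InK (c • A) := by
  obtain ⟨t, ht, s, hs, rfl⟩ := hA
  exact ⟨c * t, mul_nonneg hc ht, s, hs, by rw [smul_smul]⟩

theorem InK.add {m n : ℕ} {A B : Matrix (Fin m × Fin n) (Fin m × Fin n) ℂ} (hA : InK A)
    (hB : InK B) : InK (A + B) := by
  obtain ⟨t, ht, s, hs, rfl⟩ := hA
  obtain ⟨u, hu, r, hr, rfl⟩ := hB
  rcases eq_or_lt_of_le (add_nonneg ht hu) with h | h
  · have h1 : t = 0 := by linarith
    have h2 : u = 0 := by linarith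
    subst h1; subst h2
    exact ⟨0, le_rfl, s, hs, by simp⟩
  · refine ⟨t + u, h.le, (t / (t + u)) • s + (u / (t + u)) • r, ?_, ?_⟩
    · exact (convex_convexHull ℝ _) hs hr (by positivity) (by positivity) (by field_simp)
    · rw [smul_add, smul_smul, smul_smul, mul_div_cancel₀ _ h.ne', mul_div_cancel₀ _ h.ne']

theorem uniform_density {m : ℕ} (hm : 1 ≤ m) :
    IsDensityMatrix ((m : ℂ)⁻¹ • (1 : Matrix (Fin m) (Fin m) ℂ)) := by
  have : (m : ℂ) ≠ 0 := by exact_mod_cast (by omega : m ≠ 0)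
  refine ⟨Matrix.PosSemidef.one.smul ?_, ?_⟩
  · rw [inv_nonneg]; exact_mod_cast Nat.zero_le m
  · simp [this]

theorem uniform_sep {m n : ℕ} (hm : 1 ≤ m) (hn : 1 ≤ n) :
    ((m * n : ℂ)⁻¹ • (1 : Matrix (Fin m × Fin n) (Fin m × Fin n) ℂ)) ∈ SepStates m n := by
  apply subset_convexHull
  refine ⟨_, _, uniform_density hm, uniform_density hn, ?_⟩
  rw [Matrix.smul_kronecker, Matrix.kronecker_smul, smul_smul, Matrix.one_kronecker_one, mul_inv]

theorem density_normalize {m : ℕ} {A : Matrix (Fin m) (Fin m) ℂ} (hA : A.PosSemidef)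
    (hm : 1 ≤ m) : ∃ t : ℝ, 0 ≤ t ∧ ∃ D, IsDensityMatrix D ∧ A = (t : ℂ) • D := by
  by_cases h : A.trace = 0
  · rw [hA.trace_eq_zero_iff] at h
    exact ⟨0, le_rfl, _, uniform_density hm, by simp [h]⟩
  · have h0 := hA.trace_nonneg
    obtain ⟨t, ht⟩ : ∃ t : ℝ, A.trace = (t : ℂ) := by
      refine ⟨A.trace.re, ?_⟩
      rw [Complex.nonneg_iff] at h0
      apply Complex.ext <;> simp [h0.2.symm]
    have ht0 : 0 ≤ t := by rw [ht] at h0; exact_mod_cast h0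
    refine ⟨t, ht0, (A.trace)⁻¹ • A, ⟨hA.smul (inv_nonneg.2 h0), ?_⟩, ?_⟩
    · simp [h]
    · rw [← ht, smul_smul, mul_inv_cancel₀ h, one_smul]

theorem InK.kron {m n : ℕ} (hm : 1 ≤ m) (hn : 1 ≤ n) {A : Matrix (Fin m) (Fin m) ℂ}
    {B : Matrix (Fin n) (Fin n) ℂ} (hA : A.PosSemidef) (hB : B.PosSemidef) : InK (A ⊗ₖ B) := by
  obtain ⟨t, ht, D, hD, rfl⟩ := density_normalize hA hm
  obtain ⟨u, hu, E, hE, rfl⟩ := density_normalize hB hn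
  refine ⟨t * u, mul_nonneg ht hu, D ⊗ₖ E, subset_convexHull _ _ ⟨D, E, hD, hE, rfl⟩, ?_⟩
  rw [Matrix.smul_kronecker, Matrix.kronecker_smul, smul_smul, ← Complex.ofReal_mul]
  rfl

/-- The Hermitian matrix with entry `z` at `(i, j)` and its conjugate at `(j, i)`. -/
def WW {ι : Type*} [DecidableEq ι] (z : ℂ) (i j : ι) : Matrix ι ι ℂ :=
  Matrix.single i j z + Matrix.single j i (star z)

theorem WW_pos {m : ℕ} (z : ℂ) (hz : ‖z‖ ≤ 1) (i j : Fin m) :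
    ((2 : ℂ) • (1 : Matrix (Fin m) (Fin m) ℂ) + WW z i j).PosSemidef := by
  have h1 := Matrix.posSemidef_vecMulVec_self_star
    (Pi.single i 1 + Pi.single j (star z) : Fin m → ℂ)
  have h2 : (Matrix.diagonal (fun k => (((2 : ℝ) - (if k = i then 1 else 0)
      - (if k = j then ‖z‖ ^ 2 else 0) : ℝ) : ℂ)) : Matrix (Fin m) (Fin m) ℂ).PosSemidef := by
    apply Matrix.PosSemidef.diagonal
    intro k
    have : ‖z‖ ^ 2 ≤ 1 := by nlinarith [norm_nonneg z]
    simp only [Pi.zero_apply]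
    rw [Complex.zero_le_real]
    split_ifs <;> linarith
  convert h1.add h2 using 1
  have hzz : star z * z = ((‖z‖ ^ 2 : ℝ) : ℂ) := by
    rw [mul_comm]; simpa using Complex.mul_conj' z
  ext a b
  simp only [WW, Matrix.add_apply, Matrix.smul_apply, Matrix.one_apply, Matrix.single_apply,
    Matrix.vecMulVec_apply, Pi.add_apply, Pi.star_apply, Pi.single_apply, Matrix.diagonal_apply]
  push_cast at hzz ⊢
  by_cases hai : a = i <;> by_cases hbi : b = i <;> by_cases haj : a = j <;>
    by_cases hbj : b = j <;> by_cases hab : a = b <;> simp_all <;> grind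

theorem WW_neg {ι : Type*} [DecidableEq ι] (z : ℂ) (i j : ι) : WW (-z) i j = - WW z i j := by
  ext a b
  simp only [WW, Matrix.add_apply, Matrix.single_apply, Matrix.neg_apply, star_neg]
  split_ifs <;> ring

theorem InK.prodWW {m n : ℕ} (hm : 1 ≤ m) (hn : 1 ≤ n) (z w : ℂ) (hz : ‖z‖ ≤ 1) (hw : ‖w‖ ≤ 1)
    (i j : Fin m) (k l : Fin n) : InK ((8 : ℝ) • 1 + (2 : ℝ) • (WW z i j ⊗ₖ WW w k l)) := by
  have h1 := InK.kron hm hn (WW_pos z hz i j) (WW_pos w hw k l)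
  have h2 := InK.kron hm hn (WW_pos (-z) (by simpa using hz) i j)
    (WW_pos (-w) (by simpa using hw) k l)
  convert h1.add h2 using 1
  rw [WW_neg, WW_neg, ← Matrix.one_kronecker_one]
  ext ⟨a, b⟩ ⟨c, d⟩
  simp only [Matrix.add_apply, Matrix.smul_apply, Matrix.kronecker_apply, Matrix.neg_apply,
    Complex.real_smul, smul_eq_mul]
  push_cast
  ring

theorem InK.WWk {m n : ℕ} (hm : 1 ≤ m) (hn : 1 ≤ n) (z : ℂ) (hz : ‖z‖ ≤ 1)
    (p q : Fin m × Fin n) : InK ((4 : ℝ) • 1 + WW z p q) := by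
  obtain ⟨i, k⟩ := p
  obtain ⟨j, l⟩ := q
  have h1 := InK.prodWW hm hn z 1 hz (by simp) i j k l
  have h2 := InK.prodWW hm hn (-Complex.I * z) Complex.I (by simpa using hz) (by simp) i j k l
  convert (h1.add h2).smul (by norm_num : (0 : ℝ) ≤ 1 / 4) using 1
  have e : ∀ (i j : Fin m) (k l : Fin n) (a b : ℂ),
      Matrix.single (i, k) (j, l) (a * b) = Matrix.single i j a ⊗ₖ Matrix.single k l b := by
    intro i j k l a b
    rw [Matrix.single_kronecker_single]
  have e1 : WW z (i, k) (j, l) = Matrix.single i j z ⊗ₖ Matrix.single k l 1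
      + Matrix.single j i (star z) ⊗ₖ Matrix.single l k 1 := by
    rw [← e, ← e]; simp [WW]
  rw [e1]
  ext ⟨a, b⟩ ⟨c, d⟩
  have f : ∀ {r : ℕ} (i j a b : Fin r) (x : ℂ),
      Matrix.single i j x a b = x * Matrix.single i j (1 : ℂ) a b := by
    intro r i j a b x
    simp [Matrix.single_apply]
  simp only [WW, Matrix.add_apply, Matrix.smul_apply, Matrix.kronecker_apply,
    Complex.real_smul]
  rw [f i j a c z, f j i a c (star z), f i j a c (-Complex.I * z), f j i a c (star (-Complex.I * z)),
    f k l b d Complex.I, f l k b d (star Complex.I), f l k b d (star 1)]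
  have hI := Complex.I_mul_I
  simp only [star_mul', star_neg, Complex.star_def, Complex.conj_I, map_one]
  push_cast
  ring_nf
  simp only [Complex.I_sq]
  ring

theorem InK.sum {m n : ℕ} {ι : Type*} (hm : 1 ≤ m) (hn : 1 ≤ n) (s : Finset ι)
    (f : ι → Matrix (Fin m × Fin n) (Fin m × Fin n) ℂ) (hf : ∀ i, InK (f i)) :
    InK (∑ i ∈ s, f i) := by
  classical
  induction s using Finset.induction_on with
  | empty => exact ⟨0, le_rfl, _, uniform_sep hm hn, by simp⟩
  | insert a s ha ih => rw [Finset.sum_insert ha]; exact (hf a).add ih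

theorem InK.herm {m n : ℕ} (hm : 1 ≤ m) (hn : 1 ≤ n)
    (H : Matrix (Fin m × Fin n) (Fin m × Fin n) ℂ) (hH : H.IsHermitian)
    (h1 : ∀ p q, ‖H p q‖ ≤ 1) : InK ((4 * (m * n) ^ 2 : ℝ) • 1 + (2 : ℝ) • H) := by
  have h := InK.sum hm hn Finset.univ
    (fun p : Fin m × Fin n => ∑ q, ((4 : ℝ) • 1 + WW (H p q) p q))
    (fun p => InK.sum hm hn _ _ (fun q => InK.WWk hm hn _ (h1 p q) p q))
  convert h using 1
  simp only [Finset.sum_add_distrib, WW]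
  have h2 : ∑ p, ∑ q, Matrix.single p q (H p q) = H := (Matrix.matrix_eq_sum_single H).symm
  have h3 : ∑ p, ∑ q, Matrix.single q p (star (H p q)) = H := by
    rw [Finset.sum_comm]
    conv_rhs => rw [Matrix.matrix_eq_sum_single H]
    refine Finset.sum_congr rfl fun q _ => Finset.sum_congr rfl fun p _ => ?_
    rw [hH.apply]
  rw [h2, h3, two_smul]
  congr 1
  simp only [Finset.sum_const, Finset.card_univ, Fintype.card_prod, Fintype.card_fin]
  rw [← Nat.cast_smul_eq_nsmul ℝ, ← Nat.cast_smul_eq_nsmul ℝ, smul_smul, smul_smul]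
  congr 1
  push_cast
  ring

theorem sep_subset {m n : ℕ} : SepStates m n ⊆ {A | A.IsHermitian ∧ A.trace = 1} := by
  apply convexHull_min
  · rintro _ ⟨A, B, hA, hB, rfl⟩
    refine ⟨(hA.1.kronecker hB.1).1, ?_⟩
    rw [Matrix.trace_kronecker, hA.2, hB.2, one_mul]
  · rintro A ⟨hA, hA'⟩ B ⟨hB, hB'⟩ a b _ _ hab
    refine ⟨?_, ?_⟩
    · simp only [Matrix.IsHermitian, Matrix.conjTranspose_add, Matrix.conjTranspose_smul, hA.eq,
        hB.eq, star_trivial]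
    · rw [Matrix.trace_add, Matrix.trace_smul, Matrix.trace_smul, hA', hB', ← add_smul, hab,
        one_smul]

theorem sep_of_near {m n : ℕ} (hm : 1 ≤ m) (hn : 1 ≤ n)
    (A : Matrix (Fin m × Fin n) (Fin m × Fin n) ℂ) (hA : A.IsHermitian) (hA' : A.trace = 1)
    (h : ∀ p q, ‖(A - ((m * n : ℂ)⁻¹ • (1 : Matrix (Fin m × Fin n) (Fin m × Fin n) ℂ))) p q‖
      ≤ (2 * (m * n : ℝ) ^ 3)⁻¹) : A ∈ SepStates m n := by
  set x := ((m * n : ℂ)⁻¹ • (1 : Matrix (Fin m × Fin n) (Fin m × Fin n) ℂ)) with hx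
  have hxS := uniform_sep hm hn
  rw [← hx] at hxS
  have hN : 0 < (m * n : ℝ) := by
    have : 0 < m * n := by positivity
    exact_mod_cast this
  set s : ℝ := 2 * (m * n : ℝ) ^ 3 with hs
  have hs0 : 0 < s := by positivity
  have hH : (A - x).IsHermitian := hA.sub (sep_subset hxS).1
  have hk := InK.herm hm hn (s • (A - x)) (by
      simp only [Matrix.IsHermitian, Matrix.conjTranspose_smul, hH.eq, star_trivial]) (by
      intro p q
      rw [Matrix.smul_apply, norm_smul, Real.norm_of_nonneg hs0.le]
      calc s * _ ≤ s * s⁻¹ := by gcongr; exact h p q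
        _ = 1 := mul_inv_cancel₀ hs0.ne')
  have hk2 := hk.smul (inv_nonneg.2 (by positivity : 0 ≤ 2 * s))
  have e : (2 * s)⁻¹ • ((4 * (m * n) ^ 2 : ℝ) • 1 + (2 : ℝ) • (s • (A - x))) = A := by
    have e1 : x = (m * n : ℝ)⁻¹ • 1 := by
      rw [hx, ← Complex.coe_smul]; push_cast; rfl
    rw [smul_add, smul_smul, smul_smul, smul_smul]
    have e2 : (2 * s)⁻¹ * (4 * (m * n) ^ 2 : ℝ) = (m * n : ℝ)⁻¹ := by
      rw [hs]; field_simp; norm_num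
    have e3 : (2 * s)⁻¹ * 2 * s = 1 := by field_simp
    rw [e2, mul_assoc, ← mul_assoc, e3, one_smul, ← e1]
    abel
  rw [e] at hk2
  obtain ⟨t, ht, r, hr, hAr⟩ := hk2
  have ht1 : t = 1 := by
    have := congrArg Matrix.trace hAr
    rw [hA', Matrix.trace_smul, (sep_subset hr).2] at this
    simp only [Complex.real_smul, mul_one] at this
    exact_mod_cast this.symm
  rw [hAr, ht1, one_smul]
  exact hr

/-- Hermitian matrices of trace zero. -/
def VV (ι : Type*) [Fintype ι] : Submodule ℝ (Matrix ι ι ℂ) where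
  carrier := {A | A.IsHermitian ∧ A.trace = 0}
  add_mem' := fun ha hb => ⟨ha.1.add hb.1, by rw [Matrix.trace_add, ha.2, hb.2, add_zero]⟩
  zero_mem' := ⟨Matrix.isHermitian_zero, Matrix.trace_zero _ _⟩
  smul_mem' := fun c A hA => ⟨by
    simp only [Matrix.IsHermitian, Matrix.conjTranspose_smul, hA.1.eq, star_trivial], by
    rw [Matrix.trace_smul, hA.2, smul_zero]⟩

/-- Skew-adjoint and self-adjoint matrices are in linear bijection. -/
noncomputable def skewEquiv (ι : Type*) [Fintype ι] :
    skewAdjoint (Matrix ι ι ℂ) ≃ₗ[ℝ] selfAdjoint (Matrix ι ι ℂ) :=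
  LinearEquiv.ofBijective skewAdjoint.negISMul (by
    constructor
    · intro a b hab
      ext1
      rw [← skewAdjoint.I_smul_neg_I a, hab, skewAdjoint.I_smul_neg_I b]
    · intro b
      refine ⟨⟨Complex.I • (b : Matrix ι ι ℂ), ?_⟩, ?_⟩
      · rw [skewAdjoint.mem_iff, star_smul, b.2.star_eq]
        simp
      · ext1
        simp [skewAdjoint.negISMul, smul_smul])

theorem finrank_selfAdj (ι : Type*) [Fintype ι] :
    Module.finrank ℝ (selfAdjoint (Matrix ι ι ℂ)) = Fintype.card ι ^ 2 := by
  have e := (StarModule.decomposeProdAdjoint ℝ (Matrix ι ι ℂ)).trans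
    (LinearEquiv.prodCongr (LinearEquiv.refl ℝ _) (skewEquiv ι))
  have h := e.finrank_eq
  haveI : Module.Finite ℝ (Matrix ι ι ℂ) := Module.Finite.trans ℂ _
  haveI : Module.Finite ℝ (selfAdjoint (Matrix ι ι ℂ)) :=
    Module.Finite.of_surjective (selfAdjointPart ℝ : Matrix ι ι ℂ →ₗ[ℝ] _) (fun a =>
      ⟨a, a.2.selfAdjointPart_apply ℝ⟩)
  rw [Module.finrank_prod, ← Module.finrank_mul_finrank ℝ ℂ, Complex.finrank_real_complex,
    Module.finrank_matrix, Module.finrank_self] at h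
  rw [sq]
  omega

/-- The real trace on self-adjoint matrices. -/
noncomputable def trR (ι : Type*) [Fintype ι] : selfAdjoint (Matrix ι ι ℂ) →ₗ[ℝ] ℝ where
  toFun a := (Matrix.trace (a : Matrix ι ι ℂ)).re
  map_add' a b := by simp
  map_smul' a b := by simp

theorem finrank_VV (ι : Type*) [Fintype ι] [DecidableEq ι] [Nonempty ι] :
    Module.finrank ℝ (VV ι) = Fintype.card ι ^ 2 - 1 := by
  haveI : Module.Finite ℝ (Matrix ι ι ℂ) := Module.Finite.trans ℂ _
  haveI : Module.Finite ℝ (selfAdjoint (Matrix ι ι ℂ)) :=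
    Module.Finite.of_surjective (selfAdjointPart ℝ : Matrix ι ι ℂ →ₗ[ℝ] _) (fun a =>
      ⟨a, a.2.selfAdjointPart_apply ℝ⟩)
  have h := (trR ι).finrank_range_add_finrank_ker
  have hs : LinearMap.range (trR ι) = ⊤ := by
    apply LinearMap.range_eq_top.2
    apply LinearMap.surjective
    intro h0
    have := congrArg (fun f => f 1) h0
    simp [trR] at this
  rw [hs, finrank_top, Module.finrank_self, finrank_selfAdj] at h
  have htr : ∀ a : selfAdjoint (Matrix ι ι ℂ), (Matrix.trace (a : Matrix ι ι ℂ)).im = 0 := by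
    intro a
    have : star (Matrix.trace (a : Matrix ι ι ℂ)) = Matrix.trace (a : Matrix ι ι ℂ) := by
      rw [← Matrix.trace_conjTranspose]
      exact congrArg _ a.2
    exact Complex.conj_eq_iff_im.1 this
  let e : LinearMap.ker (trR ι) ≃ₗ[ℝ] VV ι :=
    { toFun := fun a => ⟨(a : selfAdjoint (Matrix ι ι ℂ)), (a : selfAdjoint (Matrix ι ι ℂ)).2,
        Complex.ext a.2 (htr _)⟩
      invFun := fun a => ⟨⟨a, a.2.1⟩, by
        have := congrArg Complex.re a.2.2
        exact this⟩
      map_add' := fun _ _ => rfl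
      map_smul' := fun _ _ => rfl
      left_inv := fun _ => rfl
      right_inv := fun _ => rfl }
  rw [← e.finrank_eq]
  omega

theorem span_sep {m n : ℕ} (hm : 1 ≤ m) (hn : 1 ≤ n) :
    affineSpan ℝ (SepStates m n) = AffineSubspace.mk'
      ((m * n : ℂ)⁻¹ • (1 : Matrix (Fin m × Fin n) (Fin m × Fin n) ℂ)) (VV _) := by
  have hxS := uniform_sep hm hn
  set x := ((m * n : ℂ)⁻¹ • (1 : Matrix (Fin m × Fin n) (Fin m × Fin n) ℂ)) with hx
  have hxT := sep_subset hxS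
  apply le_antisymm
  · rw [affineSpan_le]
    intro A hA
    have hA' := sep_subset hA
    change A ∈ AffineSubspace.mk' _ _
    rw [AffineSubspace.mem_mk']
    exact ⟨hA'.1.sub hxT.1, by rw [vsub_eq_sub, Matrix.trace_sub, hA'.2, hxT.2, sub_self]⟩
  · intro A hA
    rw [AffineSubspace.mem_mk', vsub_eq_sub] at hA
    obtain ⟨h1, h2⟩ := hA
    set δ : ℝ := (2 * (m * n : ℝ) ^ 3)⁻¹ with hδ
    have hδ0 : 0 < δ := by
      have : 0 < (m * n : ℝ) := by
        have : 0 < m * n := by positivity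
        exact_mod_cast this
      positivity
    set F : ℝ := ∑ p, ∑ q, ‖(A - x) p q‖ with hF
    have hF0 : 0 ≤ F := by positivity
    set ε : ℝ := δ / (1 + F) with hε
    have hε0 : 0 < ε := by positivity
    have hB : x + ε • (A - x) ∈ SepStates m n := by
      apply sep_of_near hm hn
      · refine hxT.1.add ?_
        simp only [Matrix.IsHermitian, Matrix.conjTranspose_smul, h1.eq, star_trivial]
      · rw [Matrix.trace_add, hxT.2, Matrix.trace_smul, h2, smul_zero, add_zero]
      · intro p q
        rw [← hx, add_sub_cancel_left, Matrix.smul_apply, norm_smul, Real.norm_of_nonneg hε0.le]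
        have hle : ‖(A - x) p q‖ ≤ F :=
          (Finset.single_le_sum (f := fun q => ‖(A - x) p q‖) (fun _ _ => norm_nonneg _)
            (Finset.mem_univ q)).trans
          (Finset.single_le_sum (f := fun p => ∑ q, ‖(A - x) p q‖)
            (fun _ _ => Finset.sum_nonneg fun _ _ => norm_nonneg _) (Finset.mem_univ p))
        calc ε * ‖(A - x) p q‖ ≤ ε * (1 + F) := by gcongr; linarith
          _ = δ := by rw [hε]; field_simp
    have := AffineMap.lineMap_mem (Q := affineSpan ℝ (SepStates m n)) ε⁻¹
      (subset_affineSpan ℝ _ hxS) (subset_affineSpan ℝ _ hB)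
    rw [AffineMap.lineMap_apply, vsub_eq_sub, vadd_eq_add, add_sub_cancel_left, smul_smul,
      inv_mul_cancel₀ hε0.ne', one_smul, sub_add_cancel] at this
    exact this

/-- `(1/(mn)) I_{mn}` lies in the intrinsic (relative) interior of the set `S_{m,n}` of
separable states, the affine span of `S_{m,n}` is the affine hyperplane of Hermitian
matrices of trace one, and the dimension of `S_{m,n}` as a convex set is `(mn)² - 1`. -/
theorem id_mem_intrinsicInterior_sep_states (m n : ℕ) (hm : 1 ≤ m) (hn : 1 ≤ n) :
    ((m * n : ℂ)⁻¹ • (1 : Matrix (Fin m × Fin n) (Fin m × Fin n) ℂ))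
        ∈ intrinsicInterior ℝ (SepStates m n) ∧
      (affineSpan ℝ (SepStates m n) : Set (Matrix (Fin m × Fin n) (Fin m × Fin n) ℂ)) =
        {A | A.IsHermitian ∧ A.trace = 1} ∧
      Module.finrank ℝ (affineSpan ℝ (SepStates m n)).direction = (m * n) ^ 2 - 1 := by
  have hxS := uniform_sep hm hn
  have hxT := sep_subset hxS
  have hset : (affineSpan ℝ (SepStates m n) : Set (Matrix (Fin m × Fin n) (Fin m × Fin n) ℂ)) =
        {A | A.IsHermitian ∧ A.trace = 1} := by
    rw [span_sep hm hn]
    ext A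
    rw [SetLike.mem_coe, AffineSubspace.mem_mk', vsub_eq_sub]
    constructor
    · rintro ⟨h1, h2⟩
      rw [Matrix.trace_sub, hxT.2, sub_eq_zero] at h2
      refine ⟨?_, h2⟩
      have := h1.add hxT.1
      rwa [sub_add_cancel] at this
    · rintro ⟨h1, h2⟩
      exact ⟨h1.sub hxT.1, by rw [Matrix.trace_sub, h2, hxT.2, sub_self]⟩
  refine ⟨?_, hset, ?_⟩
  · rw [mem_intrinsicInterior]
    refine ⟨⟨_, subset_affineSpan ℝ _ hxS⟩, ?_, rfl⟩
    set x := ((m * n : ℂ)⁻¹ • (1 : Matrix (Fin m × Fin n) (Fin m × Fin n) ℂ)) with hx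
    rw [mem_interior]
    have hδ0 : 0 < (2 * (m * n : ℝ) ^ 3)⁻¹ := by
      have : 0 < (m * n : ℝ) := by
        have : 0 < m * n := by positivity
        exact_mod_cast this
      positivity
    refine ⟨⋂ p, ⋂ q, {A : affineSpan ℝ (SepStates m n) |
      ‖((A : Matrix (Fin m × Fin n) (Fin m × Fin n) ℂ) - x) p q‖ < (2 * (m * n : ℝ) ^ 3)⁻¹},
      ?_, ?_, ?_⟩
    · intro A hA
      simp only [Set.mem_iInter, Set.mem_ofPred_eq] at hA
      have hA2 : (A : Matrix (Fin m × Fin n) (Fin m × Fin n) ℂ) ∈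
        {A : Matrix (Fin m × Fin n) (Fin m × Fin n) ℂ | A.IsHermitian ∧ A.trace = 1} :=
        hset ▸ A.2
      exact sep_of_near hm hn _ hA2.1 hA2.2 (fun p q => (hA p q).le)
    · refine isOpen_iInter_of_finite fun p => isOpen_iInter_of_finite fun q => ?_
      refine isOpen_lt ?_ continuous_const
      refine continuous_norm.comp ?_
      exact (continuous_subtype_val.sub continuous_const).matrix_elem p q
    · simp only [Set.mem_iInter, Set.mem_ofPred_eq]
      intro p q
      rw [← hx, sub_self, Matrix.zero_apply, norm_zero]
      exact hδ0
  · rw [span_sep hm hn, AffineSubspace.direction_mk']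
    haveI : Nonempty (Fin m × Fin n) := ⟨(⟨0, hm⟩, ⟨0, hn⟩)⟩
    rw [finrank_VV, Fintype.card_prod, Fintype.card_fin, Fintype.card_fin]
end

section
/- Let m, n ≥ 1 and let Φ : D_{mn} → D_{mn} be an affine map such that Φ(S_{m,n}) = S_{m,n}. Then Φ extends uniquely to an invertible real-linear map Ψ : H_{mn} → H_{mn}, i.e. there is a unique ℝ-linear bijection Ψ of the space of mn×mn Hermitian matrices whose restriction to D_{mn} equals Φ. -/
open Matrix Kronecker ComplexOrder

/-- The real vector space of `mn × mn` complex Hermitian matrices. -/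
noncomputable abbrev HermMat (m n : ℕ) := selfAdjoint (Matrix (Fin m × Fin n) (Fin m × Fin n) ℂ)

/-- A Hermitian matrix which is a density matrix. -/
def IsDensitySA {m n : ℕ} (A : HermMat m n) : Prop :=
  (A : Matrix (Fin m × Fin n) (Fin m × Fin n) ℂ).PosSemidef ∧
    (A : Matrix (Fin m × Fin n) (Fin m × Fin n) ℂ).trace = 1

/-- The set of bipartite separable states, viewed inside the real vector space of
Hermitian matrices: the convex hull of Kronecker products of density matrices. -/
noncomputable def SepStatesSA (m n : ℕ) : Set (HermMat m n) :=
  convexHull ℝ {C | ∃ A B, IsDensityMatrix A ∧ IsDensityMatrix B ∧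
    (C : Matrix (Fin m × Fin n) (Fin m × Fin n) ℂ) = A ⊗ₖ B}

lemma aux_span_convex {E : Type*} [AddCommGroup E] [Module ℝ E] {C : Set E}
    (hC : Convex ℝ C) (hne : C.Nonempty) {z : E} (hz : z ∈ Submodule.span ℝ C) :
    ∃ a b : ℝ, 0 ≤ a ∧ 0 ≤ b ∧ ∃ x ∈ C, ∃ y ∈ C, z = a • x - b • y := by
  have key : ∀ a b : ℝ, 0 ≤ a → 0 ≤ b → ∀ x ∈ C, ∀ y ∈ C, ∃ w ∈ C,
      a • x + b • y = (a + b) • w := by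
    intro a b ha hb x hx y hy
    rcases eq_or_lt_of_le (add_nonneg ha hb) with h | h
    · have ha0 : a = 0 := by linarith
      have hb0 : b = 0 := by linarith
      exact ⟨x, hx, by simp [ha0, hb0]⟩
    · refine ⟨(a / (a + b)) • x + (b / (a + b)) • y,
        hC hx hy (by positivity) (by positivity) (by field_simp), ?_⟩
      rw [smul_add, smul_smul, smul_smul, mul_div_cancel₀ _ h.ne', mul_div_cancel₀ _ h.ne']
  induction hz using Submodule.span_induction with
  | mem x hx => exact ⟨1, 0, zero_le_one, le_rfl, x, hx, x, hx, by simp⟩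
  | zero =>
    obtain ⟨x, hx⟩ := hne
    exact ⟨0, 0, le_rfl, le_rfl, x, hx, x, hx, by simp⟩
  | add u v _ _ hu hv =>
    obtain ⟨a, b, ha, hb, x, hx, y, hy, rfl⟩ := hu
    obtain ⟨a', b', ha', hb', x', hx', y', hy', rfl⟩ := hv
    obtain ⟨w, hw, hw'⟩ := key a a' ha ha' x hx x' hx'
    obtain ⟨q, hq, hq'⟩ := key b b' hb hb' y hy y' hy'
    refine ⟨a + a', b + b', by positivity, by positivity, w, hw, q, hq, ?_⟩
    rw [← hw', ← hq']
    abel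
  | smul c u _ hu =>
    obtain ⟨a, b, ha, hb, x, hx, y, hy, rfl⟩ := hu
    rcases le_total 0 c with hc | hc
    · exact ⟨c * a, c * b, by positivity, by positivity, x, hx, y, hy, by
        rw [smul_sub, smul_smul, smul_smul]⟩
    · refine ⟨(-c) * b, (-c) * a, mul_nonneg (by linarith) hb, mul_nonneg (by linarith) ha,
        y, hy, x, hx, by module⟩

lemma aux_extend {E : Type*} [AddCommGroup E] [Module ℝ E] {K : Set E} (hK : Convex ℝ K)
    (hne : K.Nonempty) (hspan : Submodule.span ℝ K = ⊤) (τ : E →ₗ[ℝ] ℝ)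
    (hτ : ∀ x ∈ K, τ x = 1) (f : E → E)
    (hf : ∀ x ∈ K, ∀ y ∈ K, ∀ t : ℝ, 0 ≤ t → t ≤ 1 →
      f (t • x + (1 - t) • y) = t • f x + (1 - t) • f y) :
    ∃ Ψ : E →ₗ[ℝ] E, ∀ x ∈ K, Ψ x = f x := by
  set C : Set (E × E) := (fun x => (x, f x)) '' K with hCdef
  have hC : Convex ℝ C := by
    rintro _ ⟨x, hx, rfl⟩ _ ⟨y, hy, rfl⟩ a b ha hb hab
    obtain rfl : b = 1 - a := by linarith
    refine ⟨a • x + (1 - a) • y, hK hx hy ha hb hab, ?_⟩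
    simp [hf x hx y hy a ha (by linarith)]
  have hCne : C.Nonempty := hne.image _
  have h0 : ∀ z ∈ Submodule.span ℝ C, z.1 = 0 → z.2 = 0 := by
    intro z hz hz1
    obtain ⟨a, b, ha, hb, _, ⟨x, hx, rfl⟩, _, ⟨y, hy, rfl⟩, rfl⟩ := aux_span_convex hC hCne hz
    simp only [Prod.fst_sub, Prod.smul_fst, Prod.snd_sub, Prod.smul_snd] at hz1 ⊢
    have h1 := congrArg τ hz1
    simp only [map_sub, map_smul, hτ x hx, hτ y hy, map_zero, smul_eq_mul, mul_one] at h1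
    obtain rfl : a = b := by linarith
    rcases eq_or_ne a 0 with rfl | hne
    · simp
    · rw [← smul_sub, smul_eq_zero] at hz1
      have : x = y := sub_eq_zero.1 (hz1.resolve_left hne)
      simp [this]
  have hbij : Function.Bijective (Prod.fst ∘ (Submodule.span ℝ C).subtype) := by
    constructor
    · intro u v huv
      have huv' : (u : E × E).1 = (v : E × E).1 := huv
      have := h0 (u - v : E × E) (Submodule.sub_mem _ u.2 v.2) (by simp [huv'])
      exact Subtype.ext (Prod.ext huv' (sub_eq_zero.1 this))
    · intro x
      have hx : x ∈ (Submodule.span ℝ C).map (LinearMap.fst ℝ E E) := by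
        rw [Submodule.map_span, hCdef, Set.image_image]
        simp [hspan]
      obtain ⟨y, hy, rfl⟩ := hx
      exact ⟨⟨y, hy⟩, rfl⟩
  obtain ⟨Ψ, hΨ⟩ := Submodule.exists_eq_graph hbij
  refine ⟨Ψ, fun x hx => ?_⟩
  have : (x, f x) ∈ Submodule.span ℝ C := Submodule.subset_span ⟨x, hx, rfl⟩
  rw [hΨ, LinearMap.mem_graph_iff] at this
  exact this.symm

open scoped MatrixOrder Matrix.Norms.L2Operator in
lemma aux_span_density (m : ℕ) :
    Submodule.span ℂ {A : Matrix (Fin m) (Fin m) ℂ | IsDensityMatrix A} = ⊤ := by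
  rw [eq_top_iff, ← CStarAlgebra.span_nonneg, Submodule.span_le]
  intro A hA
  have hA : A.PosSemidef := Matrix.nonneg_iff_posSemidef.1 hA
  by_cases h : A.trace = 0
  · rw [hA.trace_eq_zero_iff.1 h]
    exact Submodule.zero_mem _
  · have h2 : A = A.trace • ((A.trace)⁻¹ • A) := by
      rw [smul_smul, mul_inv_cancel₀ h, one_smul]
    rw [h2]
    refine Submodule.smul_mem _ _ (Submodule.subset_span ⟨?_, ?_⟩)
    · refine hA.smul ?_
      have := hA.trace_nonneg
      exact inv_nonneg.2 this
    · rw [Matrix.trace_smul, smul_eq_mul, inv_mul_cancel₀ h]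

lemma aux_span_prod (m n : ℕ) :
    Submodule.span ℂ {C : Matrix (Fin m × Fin n) (Fin m × Fin n) ℂ |
      ∃ A B, IsDensityMatrix A ∧ IsDensityMatrix B ∧ C = A ⊗ₖ B} = ⊤ := by
  have h := Submodule.map₂_span_span ℂ (Matrix.kroneckerBilinear (R := ℂ) (α := ℂ)
    (l := Fin m) (m := Fin m) (n := Fin n) (p := Fin n))
    {A : Matrix (Fin m) (Fin m) ℂ | IsDensityMatrix A}
    {A : Matrix (Fin n) (Fin n) ℂ | IsDensityMatrix A}
  rw [aux_span_density, aux_span_density] at h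
  have hs : Set.image2 (fun a b => Matrix.kroneckerBilinear (R := ℂ) (α := ℂ) a b)
      {A : Matrix (Fin m) (Fin m) ℂ | IsDensityMatrix A}
      {A : Matrix (Fin n) (Fin n) ℂ | IsDensityMatrix A} =
      {C : Matrix (Fin m × Fin n) (Fin m × Fin n) ℂ |
      ∃ A B, IsDensityMatrix A ∧ IsDensityMatrix B ∧ C = A ⊗ₖ B} := by
    ext C
    constructor
    · rintro ⟨A, hA, B, hB, rfl⟩
      exact ⟨A, B, hA, hB, rfl⟩
    · rintro ⟨A, B, hA, hB, rfl⟩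
      exact ⟨A, hA, B, hB, rfl⟩
  rw [← hs, ← h, eq_top_iff]
  intro X _
  rw [Matrix.matrix_eq_sum_single X]
  refine Submodule.sum_mem _ fun p _ => Submodule.sum_mem _ fun q _ => ?_
  have : Matrix.single p q (X p q) =
      Matrix.kroneckerBilinear (R := ℂ) (α := ℂ) (Matrix.single p.1 q.1 (X p q))
        (Matrix.single p.2 q.2 1) := by
    change _ = Matrix.single p.1 q.1 (X p q) ⊗ₖ Matrix.single p.2 q.2 1
    rw [Matrix.single_kronecker_single, mul_one]
  rw [this]
  exact Submodule.apply_mem_map₂ _ trivial trivial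

lemma aux_span_sep (m n : ℕ) : Submodule.span ℝ (SepStatesSA m n) = ⊤ := by
  rw [eq_top_iff]
  intro H _
  have key : ∀ X : Matrix (Fin m × Fin n) (Fin m × Fin n) ℂ, ∀ c : ℂ,
      realPart (c • X) ∈ Submodule.span ℝ (SepStatesSA m n) := by
    intro X
    have hX : X ∈ Submodule.span ℂ {C : Matrix (Fin m × Fin n) (Fin m × Fin n) ℂ |
      ∃ A B, IsDensityMatrix A ∧ IsDensityMatrix B ∧ C = A ⊗ₖ B} := by
      rw [aux_span_prod]; trivial
    induction hX using Submodule.span_induction with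
    | mem x hx =>
      obtain ⟨A, B, hA, hB, rfl⟩ := hx
      intro c
      have hsa : IsSelfAdjoint (A ⊗ₖ B) := (hA.1.kronecker hB.1).1
      have hmem : (⟨A ⊗ₖ B, hsa⟩ : HermMat m n) ∈ SepStatesSA m n :=
        subset_convexHull ℝ _ ⟨A, B, hA, hB, rfl⟩
      have : realPart (c • (A ⊗ₖ B)) = c.re • (⟨A ⊗ₖ B, hsa⟩ : HermMat m n) := by
        rw [realPart_smul, hsa.imaginaryPart, smul_zero, sub_zero]
        congr 1
        exact Subtype.ext hsa.coe_realPart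
      rw [this]
      exact Submodule.smul_mem _ _ (Submodule.subset_span hmem)
    | zero => intro c; simp
    | add x y _ _ hx hy =>
      intro c
      rw [smul_add, map_add]
      exact Submodule.add_mem _ (hx c) (hy c)
    | smul a x _ hx =>
      intro c
      rw [smul_smul]
      exact hx _
  have h1 := key H 1
  rw [one_smul] at h1
  have : realPart (H : Matrix (Fin m × Fin n) (Fin m × Fin n) ℂ) = H :=
    Subtype.ext (IsSelfAdjoint.coe_realPart H.2)
  rwa [this] at h1

lemma aux_density_convex (m n : ℕ) : Convex ℝ {A : HermMat m n | IsDensitySA A} := by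
  intro A hA B hB a b ha hb hab
  refine ⟨?_, ?_⟩
  · have h1 := hA.1.smul ha
    have h2 := hB.1.smul hb
    exact h1.add h2
  · have : ((a • A + b • B : HermMat m n) : Matrix (Fin m × Fin n) (Fin m × Fin n) ℂ) =
      a • (A : Matrix (Fin m × Fin n) (Fin m × Fin n) ℂ) + b • (B : Matrix _ _ ℂ) := rfl
    rw [this, Matrix.trace_add, Matrix.trace_smul, Matrix.trace_smul, hA.2, hB.2, ← add_smul, hab,
      one_smul]

lemma aux_sep_subset (m n : ℕ) : SepStatesSA m n ⊆ {A : HermMat m n | IsDensitySA A} := by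
  refine convexHull_min ?_ (aux_density_convex m n)
  rintro C ⟨A, B, hA, hB, hC⟩
  refine ⟨?_, ?_⟩
  · rw [hC]; exact hA.1.kronecker hB.1
  · rw [hC, Matrix.trace_kronecker, hA.2, hB.2, mul_one]

lemma aux_density_nonempty (m : ℕ) (hm : 1 ≤ m) :
    ∃ A : Matrix (Fin m) (Fin m) ℂ, IsDensityMatrix A := by
  by_contra! h
  have h1 := aux_span_density m
  have h2 : {A : Matrix (Fin m) (Fin m) ℂ | IsDensityMatrix A} = ∅ := by
    ext A; simpa using h A
  rw [h2, Submodule.span_empty] at h1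
  have h3 : (1 : Matrix (Fin m) (Fin m) ℂ) ∈ (⊥ : Submodule ℂ (Matrix (Fin m) (Fin m) ℂ)) := by
    rw [h1]; trivial
  haveI : Nonempty (Fin m) := ⟨⟨0, hm⟩⟩
  exact one_ne_zero ((Submodule.mem_bot ℂ).1 h3)

/-- If `Φ : D_{mn} → D_{mn}` is an affine map with `Φ(S_{m,n}) = S_{m,n}`, then `Φ` extends
uniquely to an invertible real-linear map `Ψ` of the space of Hermitian matrices: there is a
unique `ℝ`-linear bijection of `H_{mn}` whose restriction to the density matrices is `Φ`. -/
theorem affine_sep_preserver_extends_to_linear_bijection (m n : ℕ) (hm : 1 ≤ m) (hn : 1 ≤ n)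
    (Φ : HermMat m n → HermMat m n)
    (hΦD : ∀ A : HermMat m n, IsDensitySA A → IsDensitySA (Φ A))
    (hΦaff : ∀ A B : HermMat m n, IsDensitySA A → IsDensitySA B →
      ∀ t : ℝ, 0 ≤ t → t ≤ 1 → Φ (t • A + (1 - t) • B) = t • Φ A + (1 - t) • Φ B)
    (hΦS : Φ '' SepStatesSA m n = SepStatesSA m n) :
    ∃! Ψ : HermMat m n →ₗ[ℝ] HermMat m n,
      Function.Bijective Ψ ∧ ∀ A : HermMat m n, IsDensitySA A → Ψ A = Φ A := by
  have hspanS := aux_span_sep m n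
  have hsub := aux_sep_subset m n
  have hspanD : Submodule.span ℝ {A : HermMat m n | IsDensitySA A} = ⊤ := by
    rw [eq_top_iff, ← hspanS]
    exact Submodule.span_mono hsub
  have hneS : (SepStatesSA m n).Nonempty := by
    obtain ⟨A, hA⟩ := aux_density_nonempty m hm
    obtain ⟨B, hB⟩ := aux_density_nonempty n hn
    exact ⟨⟨A ⊗ₖ B, (hA.1.kronecker hB.1).1⟩, subset_convexHull ℝ _ ⟨A, B, hA, hB, rfl⟩⟩
  let τ : HermMat m n →ₗ[ℝ] ℝ :=
    { toFun := fun A => (Matrix.trace (A : Matrix (Fin m × Fin n) (Fin m × Fin n) ℂ)).re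
      map_add' := by intro A B; simp
      map_smul' := by intro c A; simp [Matrix.trace_smul] }
  obtain ⟨Ψ, hΨ⟩ := aux_extend (aux_density_convex m n) (hneS.mono hsub) hspanD τ
    (fun x hx => by
      change (Matrix.trace (x : Matrix (Fin m × Fin n) (Fin m × Fin n) ℂ)).re = 1
      rw [hx.2]; simp) Φ
    (fun x hx y hy => hΦaff x y hx hy)
  have hsurj : Function.Surjective Ψ := by
    rw [← LinearMap.range_eq_top, eq_top_iff, ← hspanS, Submodule.span_le]
    intro x hx
    rw [← hΦS] at hx
    obtain ⟨y, hy, rfl⟩ := hx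
    exact ⟨y, hΨ y (hsub hy)⟩
  haveI : FiniteDimensional ℝ (HermMat m n) :=
    FiniteDimensional.of_injective
      (selfAdjoint.submodule ℝ (Matrix (Fin m × Fin n) (Fin m × Fin n) ℂ)).subtype
      Subtype.val_injective
  refine ⟨Ψ, ⟨⟨LinearMap.injective_iff_surjective.2 hsurj, hsurj⟩, fun A hA => hΨ A hA⟩, ?_⟩
  rintro Ψ' ⟨-, h'⟩
  refine LinearMap.ext_on hspanD fun A hA => ?_
  rw [h' A hA, hΨ A hA]
end

section
/- Let m, n ≥ 2 and let Ψ : H_{mn} → H_{mn} be an ℝ-linear map on the space of mn×mn Hermitian matrices (identified with H_m ⊗ H_n via the Kronecker product). Then Ψ(P_m ⊗ P_n) = P_m ⊗ P_n (where P_m ⊗ P_n = {P ⊗ Q : P ∈ P_m, Q ∈ P_n}) if and only if there exist unitary matrices U ∈ M_m and V ∈ M_n such that either (c.1) Ψ(A ⊗ B) = ψ₁(A) ⊗ ψ₂(B) for all A ∈ H_m, B ∈ H_n, or (c.2) m = n and Ψ(A ⊗ B) = ψ₂(B) ⊗ ψ₁(A) for all A ∈ H_m, B ∈ H_n, where ψ₁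 has the form A ↦ UAU* or A ↦ UAᵀU*, and ψ₂ has the form B ↦ VBV* or B ↦ VBᵀV*. -/
open Matrix Kronecker

/-- The real vector space of `m × m` complex Hermitian matrices. -/
noncomputable abbrev Herm (m : ℕ) := selfAdjoint (Matrix (Fin m) (Fin m) ℂ)

/-- A pure state: a rank-one Hermitian matrix of trace one. -/
def IsPureState {m : ℕ} (A : Matrix (Fin m) (Fin m) ℂ) : Prop :=
  A.IsHermitian ∧ A.rank = 1 ∧ A.trace = 1

/-- The Kronecker product of two Hermitian matrices, as a Hermitian matrix. -/
noncomputable def kronSA {m n : ℕ} (A : Herm m) (B : Herm n) : HermMat m n :=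
  ⟨(A : Matrix (Fin m) (Fin m) ℂ) ⊗ₖ (B : Matrix (Fin n) (Fin n) ℂ), by
    have hA : (A : Matrix (Fin m) (Fin m) ℂ).IsHermitian := A.2
    have hB : (B : Matrix (Fin n) (Fin n) ℂ).IsHermitian := B.2
    show Matrix.IsHermitian _
    ext ⟨a, b⟩ ⟨c, d⟩
    simp only [Matrix.conjTranspose_apply, Matrix.kroneckerMap_apply, star_mul']
    rw [← Matrix.conjTranspose_apply, ← Matrix.conjTranspose_apply, hA.eq, hB.eq]⟩

/-- The set of pure product states `P_m ⊗ P_n` inside `H_{mn}`. -/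
def PureProd (m n : ℕ) : Set (HermMat m n) :=
  {C | ∃ P Q, IsPureState P ∧ IsPureState Q ∧
    (C : Matrix (Fin m × Fin n) (Fin m × Fin n) ℂ) = P ⊗ₖ Q}

section
variable {R : Type*} [Ring R] [Algebra ℂ R]

theorem idem_parity (A B X Y : R) (hA : A * A = A) (hB : B * B = B) (c s t u : ℂ) (hcs : c * s ≠ 0)
    (h1 : ((c*c) • A + (s*s) • B + (c*s) • (u • X + t • Y)) *
      ((c*c) • A + (s*s) • B + (c*s) • (u • X + t • Y)) =
      ((c*c) • A + (s*s) • B + (c*s) • (u • X + t • Y)))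
    (h2 : ((c*c) • A + (s*s) • B + (c*s) • ((-u) • X + (-t) • Y)) *
      ((c*c) • A + (s*s) • B + (c*s) • ((-u) • X + (-t) • Y)) =
      ((c*c) • A + (s*s) • B + (c*s) • ((-u) • X + (-t) • Y))) :
    u • ((c*c) • (A * X + X * A) + (s*s) • (B * X + X * B) - X) +
    t • ((c*c) • (A * Y + Y * A) + (s*s) • (B * Y + Y * B) - Y) = 0 ∧
    (c*c*c*c) • A + (s*s*s*s) • B + (c*c*s*s) • (A * B + B * A) + 
      (c*c*s*s) • ((u*u) • (X * X) + (t*t) • (Y*Y) + (u*t) • (X*Y+Y*X)) = (c*c) • A + (s*s) • B := by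
  simp only [mul_add, add_mul, smul_mul_assoc, mul_smul_comm, smul_add, smul_smul, hA, hB] at *
  constructor
  · have : (c * s) • (u • ((c*c) • (A * X + X * A) + (s*s) • (B * X + X * B) - X) +
      t • ((c*c) • (A * Y + Y * A) + (s*s) • (B * Y + Y * B) - Y)) = 0 := by
      linear_combination (norm := module) (1/2:ℂ) • h1 - (1/2:ℂ) • h2
    have := (smul_eq_zero.1 this).resolve_left hcs
    simpa only [mul_add, add_mul, smul_mul_assoc, mul_smul_comm, smul_add, smul_smul] using this
  · linear_combination (norm := module) (1/2:ℂ) • h1 + (1/2:ℂ) • h2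

/-- Fourier expansion of idempotency along a circle of vectors. -/
theorem idem_fourier (A B X Y : R)
    (h : ∀ c s t u : ℂ, (c * c + s * s = 1 ∧ star c = c ∧ star s = s) → (u = star t ∧ u * t = 1) →
      ((c*c) • A + (s*s) • B + (c*s) • (u • X + t • Y)) *
      ((c*c) • A + (s*s) • B + (c*s) • (u • X + t • Y)) =
      ((c*c) • A + (s*s) • B + (c*s) • (u • X + t • Y)))
    (hA : A * A = A) (hB : B * B = B) :
    A * X + X * A = X ∧ B * X + X * B = X ∧ X * X = 0 ∧ A * B + B * A + X * Y + Y * X = A + B := by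
  have key := fun (c s t u : ℂ) h0 (h1 : c * c + s * s = 1 ∧ star c = c ∧ star s = s) (h2 : u = star t ∧ u * t = 1) =>
    idem_parity A B X Y hA hB c s t u h0 (h c s t u h1 h2) (h c s (-t) (-u) h1 (by simpa using h2))
  have v1 : (3/5 * (3/5) + 4/5 * (4/5) = (1:ℂ) ∧ star (3/5:ℂ) = 3/5 ∧ star (4/5:ℂ) = 4/5) := by
    refine ⟨by norm_num, ?_, ?_⟩ <;> simp
  have v2 : (4/5 * (4/5) + 3/5 * (3/5) = (1:ℂ) ∧ star (4/5:ℂ) = 4/5 ∧ star (3/5:ℂ) = 3/5) := by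
    refine ⟨by norm_num, ?_, ?_⟩ <;> simp
  have n1 : (3/5 * (4/5) : ℂ) ≠ 0 := by norm_num
  have n2 : (4/5 * (3/5) : ℂ) ≠ 0 := by norm_num
  have w1 : (1:ℂ) = star 1 ∧ (1:ℂ) * 1 = 1 := by simp
  have w2 : (-Complex.I) = star Complex.I ∧ (-Complex.I) * Complex.I = 1 := by simp
  have w3 : (3/5 - 4/5 * Complex.I) = star (3/5 + 4/5 * Complex.I) ∧
      (3/5 - 4/5 * Complex.I) * (3/5 + 4/5 * Complex.I) = 1 := by
    refine ⟨by apply Complex.ext <;> simp, ?_⟩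
    linear_combination (-16/25) * Complex.I_mul_I
  have h1 := key (3/5) (4/5) 1 1 n1 v1 w1
  have h2 := key (3/5) (4/5) _ _ n1 v1 w2
  have h3 := key (3/5) (4/5) _ _ n1 v1 w3
  have k1 := key (4/5) (3/5) 1 1 n2 v2 w1
  have k2 := key (4/5) (3/5) _ _ n2 v2 w2
  clear key h
  have odd : ∀ c s : ℂ, 
     (1:ℂ) • ((c*c) • (A * X + X * A) + (s*s) • (B * X + X * B) - X) +
      (1:ℂ) • ((c*c) • (A * Y + Y * A) + (s*s) • (B * Y + Y * B) - Y) = 0 →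
     (-Complex.I) • ((c*c) • (A * X + X * A) + (s*s) • (B * X + X * B) - X) +
      Complex.I • ((c*c) • (A * Y + Y * A) + (s*s) • (B * Y + Y * B) - Y) = 0 →
      (c*c) • (A * X + X * A) + (s*s) • (B * X + X * B) = X := by
    intro c s e1 e2
    rw [← sub_eq_zero]
    generalize ((c*c) • (A * X + X * A) + (s*s) • (B * X + X * B) - X) = S at *
    generalize ((c*c) • (A * Y + Y * A) + (s*s) • (B * Y + Y * B) - Y) = T at *
    have e3 : Complex.I • (T - S) = 0 := by rw [← e2]; module
    have e4 := (smul_eq_zero.1 e3).resolve_left Complex.I_ne_zero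
    linear_combination (norm := module) (1/2 : ℂ) • e1 - (1/2 : ℂ) • e4
  have o1 := odd _ _ h1.1 h2.1
  have o2 := odd _ _ k1.1 k2.1
  have f1 := h1.2
  have f2 := h2.2
  have f3 := h3.2
  rw [w1.2] at f1
  rw [w2.2] at f2
  rw [w3.2] at f3
  rw [show (-Complex.I) * -Complex.I = -1 by simp, Complex.I_mul_I] at f2
  rw [show (3/5 - 4/5 * Complex.I) * (3/5 - 4/5 * Complex.I) = -7/25 - 24/25 * Complex.I by
      linear_combination (16/25) * Complex.I_mul_I, 
      show (3/5 + 4/5 * Complex.I) * (3/5 + 4/5 * Complex.I) = -7/25 + 24/25 * Complex.I by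
      linear_combination (16/25) * Complex.I_mul_I] at f3
  have g1 : X * X + Y * Y = 0 := by
    linear_combination (norm := module) (625/288:ℂ) • f1 - (625/288:ℂ) • f2
  have g2 : Complex.I • (X * X) = 0 := by
    linear_combination (norm := module) (625/144*25/48:ℂ) • f1 - (625/144*25/48:ℂ) • f3 - (25/48:ℂ)• g1 + (-7/48 + 1/2*Complex.I) • g1
  refine ⟨?_, ?_, ?_, ?_⟩
  · linear_combination (norm := module) (25 * (16/7) / 25 : ℂ) • o2 - (25 * (9/7) / 25 : ℂ) • o1
  · linear_combination (norm := module) (25 * (16/7) / 25 : ℂ) • o1 - (25 * (9/7) / 25 : ℂ) • o2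
  · exact (smul_eq_zero.1 g2).resolve_left Complex.I_ne_zero
  · linear_combination (norm := module) (625/144:ℂ) • f1 - g1

end

section
variable {α β γ δ : Type*}

theorem clique_cases {S : Type*} (F : S → γ × δ) (h : ∀ s t, (F s).1 = (F t).1 ∨ (F s).2 = (F t).2) :
    (∀ s t, (F s).1 = (F t).1) ∨ (∀ s t, (F s).2 = (F t).2) := by
  by_contra! hc
  obtain ⟨⟨s, t, hst⟩, ⟨u, v, huv⟩⟩ := hc
  have := h s t
  have := h s u
  have := h s v
  have := h t u
  have := h t v
  have := h u v
  grind

theorem grid_rows [Nontrivial α] [Nontrivial β] [Nontrivial γ] [Nontrivial δ] (F : α × β ≃ γ × δ)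
    (h1 : ∀ p q, (p.1 = q.1 ∨ p.2 = q.2) → ((F p).1 = (F q).1 ∨ (F p).2 = (F q).2))
    (a0 : α)
    (hall : ∀ a, ∀ b b', (F (a, b)).1 = (F (a, b')).1) :
    ∃ (f : α → γ) (g : β → δ), ∀ a b, F (a, b) = (f a, g b) := by
  obtain ⟨b0, b1, hb⟩ := exists_pair_ne β
  have hc : ∀ b, ∀ a a', (F (a, b)).2 = (F (a', b)).2 := by
    intro b
    rcases clique_cases (fun a => F (a, b)) (fun a a' => h1 _ _ (Or.inr rfl)) with h | h
    · exfalso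
      obtain ⟨c, d, hcd⟩ := exists_pair_ne γ
      obtain ⟨e, -, -⟩ := exists_pair_ne δ
      apply hcd
      have k : ∀ x, (F x).1 = (F (a0, b)).1 := fun x => by
        rw [← h x.1 a0, ← hall x.1 x.2 b]
      have k1 := k (F.symm (c, e))
      have k2 := k (F.symm (d, e))
      simp at k1 k2
      rw [k1, k2]
    · exact h
  exact ⟨fun a => (F (a, b0)).1, fun b => (F (a0, b)).2, fun a b => Prod.ext (hall _ _ _) (hc _ _ _)⟩

/-- If one row goes to a row then all rows do. -/
theorem grid_all [Nontrivial α] [Nontrivial β] [Nontrivial γ] [Nontrivial δ] (F : α × β ≃ γ × δ)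
    (h1 : ∀ p q, (p.1 = q.1 ∨ p.2 = q.2) → ((F p).1 = (F q).1 ∨ (F p).2 = (F q).2))
    (h2 : ∀ p q, (p.1 = q.1 ∨ p.2 = q.2) → ((F.symm p).1 = (F.symm q).1 ∨ (F.symm p).2 = (F.symm q).2))
    (a0 : α) (hr : ∀ b b', (F (a0, b)).1 = (F (a0, b')).1) :
    ∀ a, ∀ b b', (F (a, b)).1 = (F (a, b')).1 := by
  intro a
  rcases clique_cases (fun b => F (a, b)) (fun b b' => h1 _ _ (Or.inl rfl)) with h | h
  · exact h
  exfalso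
  obtain ⟨b0, b1, hb⟩ := exists_pair_ne β
  -- full row
  have full1 : ∀ d, (F.symm ((F (a0, b0)).1, d)).1 = a0 := by
    have := clique_cases (fun d => F.symm ((F (a0, b0)).1, d)) (fun b b' => h2 _ _ (Or.inl rfl))
    rcases this with k | k
    · intro d
      rw [k d (F (a0,b0)).2]; simp
    · exfalso
      have := k (F (a0,b0)).2 (F (a0,b1)).2
      rw [hr b0 b1] at this
      have e : (F.symm ((F (a0, b1)).1, (F (a0, b0)).2)) = (a0, b0) := by
        rw [← hr b0 b1]; simp
      simp [e] at this
      exact hb this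
  have full2 : ∀ c, (F.symm (c, (F (a, b0)).2)).1 = a := by
    have := clique_cases (fun c => F.symm (c, (F (a, b0)).2)) (fun b b' => h2 _ _ (Or.inr rfl))
    rcases this with k | k
    · intro d
      rw [k d (F (a,b0)).1]; simp
    · exfalso
      have := k (F (a,b0)).1 (F (a,b1)).1
      have e : (F.symm ((F (a, b1)).1, (F (a, b0)).2)) = (a, b1) := by
        have := h b0 b1
        rw [this]; simp
      simp [e] at this
      exact hb this
  have e1 := full1 (F (a, b0)).2
  have e2 := full2 (F (a0, b0)).1
  have e : a0 = a := e1.symm.trans e2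
  subst e
  exact hb (congrArg Prod.snd (F.injective (Prod.ext (hr b0 b1) (h b0 b1))))

theorem grid_main [Nontrivial α] [Nontrivial β] [Nontrivial γ] [Nontrivial δ] (F : α × β ≃ γ × δ)
    (h1 : ∀ p q, (p.1 = q.1 ∨ p.2 = q.2) → ((F p).1 = (F q).1 ∨ (F p).2 = (F q).2))
    (h2 : ∀ p q, (p.1 = q.1 ∨ p.2 = q.2) → ((F.symm p).1 = (F.symm q).1 ∨ (F.symm p).2 = (F.symm q).2)) :
    (∃ (f : α → γ) (g : β → δ), ∀ a b, F (a, b) = (f a, g b)) ∨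
    (∃ (f : α → δ) (g : β → γ), ∀ a b, F (a, b) = (g b, f a)) := by
  obtain ⟨a0, -, -⟩ := exists_pair_ne α
  rcases clique_cases (fun b => F (a0, b)) (fun b b' => h1 _ _ (Or.inl rfl)) with h | h
  · exact Or.inl (grid_rows F h1 a0 (grid_all F h1 h2 a0 h))
  · right
    have h1' : ∀ p q, (p.1 = q.1 ∨ p.2 = q.2) → (((F.trans (Equiv.prodComm _ _)) p).1 = ((F.trans (Equiv.prodComm _ _)) q).1 ∨ ((F.trans (Equiv.prodComm _ _)) p).2 = ((F.trans (Equiv.prodComm _ _)) q).2) :=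
      fun p q hpq => (h1 p q hpq).symm
    obtain ⟨f, g, hfg⟩ := grid_rows (F.trans (Equiv.prodComm _ _)) h1' a0
      (grid_all _ h1' (fun p q hpq => h2 p.swap q.swap hpq.symm) a0 h)
    exact ⟨f, g, fun a b => by
      have := congrArg Prod.swap (hfg a b)
      simpa using this⟩
end
set_option linter.unusedSectionVars false
open scoped ComplexOrder in
theorem trace_star_mul_real {ι : Type*} [Fintype ι] (M : Matrix ι ι ℂ) (r : ℝ) (h : (Mᴴ * M).trace = r) : 0 ≤ r ∧ (r = 0 → M = 0) := by
  constructor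
  · have h3 := (Matrix.posSemidef_conjTranspose_mul_self M).trace_nonneg
    rw [h] at h3
    exact_mod_cast h3
  · rintro rfl
    rw [Complex.ofReal_zero, Matrix.trace_conjTranspose_mul_self_eq_zero_iff] at h
    exact h

section
variable {ι κ : Type*} [Fintype ι] [DecidableEq ι] [Fintype κ] [DecidableEq κ]

/-- The set of rank-one projections. -/
def PureSet (ι : Type*) [Fintype ι] : Set (Matrix ι ι ℂ) :=
  {P | ∃ x : ι → ℂ, star x ⬝ᵥ x = 1 ∧ P = vecMulVec x (star x)}

theorem pure_herm {P : Matrix ι ι ℂ} (h : P ∈ PureSet ι) : Pᴴ = P := by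
  obtain ⟨x, hx, rfl⟩ := h
  simp [conjTranspose_vecMulVec]

theorem pure_idem {P : Matrix ι ι ℂ} (h : P ∈ PureSet ι) : P * P = P := by
  obtain ⟨x, hx, rfl⟩ := h
  simp [vecMulVec_mul_vecMulVec, hx]

theorem pure_trace {P : Matrix ι ι ℂ} (h : P ∈ PureSet ι) : P.trace = 1 := by
  obtain ⟨x, hx, rfl⟩ := h
  rw [trace_vecMulVec, dotProduct_comm, hx]

theorem star_dot_real (x : ι → ℂ) : star x ⬝ᵥ x = ((∑ i, ‖x i‖ ^ 2 : ℝ) : ℂ) := by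
  simp [dotProduct, Complex.conj_mul']

theorem exists_unit (x : ι → ℂ) (hx : x ≠ 0) : ∃ (r : ℝ) (y : ι → ℂ), 0 < r ∧ star y ⬝ᵥ y = 1 ∧
    x = (r : ℂ) • y := by
  have hpos : 0 < ∑ i, ‖x i‖ ^ 2 := by
    obtain ⟨i, hi⟩ := Function.ne_iff.1 hx
    exact Finset.sum_pos' (fun _ _ => by positivity) ⟨i, Finset.mem_univ _, by
      have : 0 < ‖x i‖ := norm_pos_iff.2 hi
      positivity⟩
  set s := ∑ i, ‖x i‖ ^ 2 with hs
  have hr : 0 < Real.sqrt s := Real.sqrt_pos.2 hpos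
  have hne : ((Real.sqrt s : ℝ) : ℂ) ≠ 0 := by exact_mod_cast hr.ne'
  refine ⟨Real.sqrt s, ((Real.sqrt s : ℝ) : ℂ)⁻¹ • x, hr, ?_, ?_⟩
  · rw [star_smul, smul_dotProduct, dotProduct_smul, star_dot_real, ← hs]
    simp only [star_inv₀, Complex.star_def, Complex.conj_ofReal, smul_eq_mul]
    have : ((Real.sqrt s : ℝ) : ℂ) * ((Real.sqrt s : ℝ) : ℂ) = s := by
      exact_mod_cast Real.mul_self_sqrt hpos.le
    field_simp
    rw [pow_two, this]
  · rw [smul_smul, mul_inv_cancel₀ hne, one_smul]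

theorem pure_of_herm {P : Matrix ι ι ℂ} (u v : ι → ℂ) (h : P = vecMulVec u v) (hh : Pᴴ = P)
    (ht : P.trace = 1) : P ∈ PureSet ι := by
  have h1 : v ⬝ᵥ u = 1 := by rw [← ht, h, trace_vecMulVec, dotProduct_comm]
  have hu : u ≠ 0 := by rintro rfl; simp at h1
  obtain ⟨r, y, hr, hy, rfl⟩ := exists_unit u hu
  refine ⟨y, hy, ?_⟩
  have h2 : P * P = P := by rw [h, vecMulVec_mul_vecMulVec, h1, one_smul]
  have hP : P = vecMulVec y ((r:ℂ) • v) := by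
    rw [h]; ext i j; simp [vecMulVec_apply]; ring
  generalize ((r:ℂ) • v) = w at hP
  have h3 : P *ᵥ y = y := by
    have : P *ᵥ ((r:ℂ) • y) = (r:ℂ) • y := by
      rw [h, vecMulVec_mulVec, h1, MulOpposite.op_one, one_smul]
    rw [mulVec_smul] at this
    exact smul_right_injective _ (by exact_mod_cast hr.ne' : (r:ℂ) ≠ 0) this
  have h4 : vecMulVec y (star y) * P = P := by
    rw [hP, vecMulVec_mul_vecMulVec, hy, one_smul]
  have h5 : P * vecMulVec y (star y) = vecMulVec y (star y) := by
    rw [mul_vecMulVec, h3]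
  have h6 : vecMulVec y (star y) * P = vecMulVec y (star y) := by
    have := congrArg conjTranspose h5
    rw [conjTranspose_mul, hh] at this
    simpa [conjTranspose_vecMulVec] using this
  rw [← h4, h6]

theorem isPureState_iff {m : ℕ} {P : Matrix (Fin m) (Fin m) ℂ} :
    (P.IsHermitian ∧ P.rank = 1 ∧ P.trace = 1) ↔ P ∈ PureSet (Fin m) := by
  constructor
  · rintro ⟨h1, h2, h3⟩
    have hr : Module.finrank ℂ (LinearMap.range P.mulVecLin) = 1 := h2
    obtain ⟨⟨u, hu⟩, -, hspan⟩ := finrank_eq_one_iff'.1 hr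
    have : ∀ j, ∃ c : ℂ, c • u = P.col j := by
      intro j
      obtain ⟨c, hc⟩ := hspan ⟨P.col j, ⟨Pi.single j 1, by simp⟩⟩
      exact ⟨c, congrArg Subtype.val hc⟩
    choose c hc using this
    refine pure_of_herm u c ?_ h1 h3
    ext i j
    have := congrFun (hc j) i
    simp at this
    rw [vecMulVec_apply, ← this, mul_comm]
  · intro h
    refine ⟨pure_herm h, ?_, pure_trace h⟩
    have h0 := pure_trace h
    obtain ⟨x, hx, rfl⟩ := h
    apply le_antisymm (rank_vecMulVec_le _ _)
    rw [Nat.one_le_iff_ne_zero]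
    intro hr
    have hr' : Module.finrank ℂ (LinearMap.range (vecMulVec x (star x)).mulVecLin) = 0 := hr
    rw [Submodule.finrank_eq_zero, LinearMap.range_eq_bot] at hr'
    have h5 : vecMulVec x (star x) *ᵥ x = 0 := by
      rw [← Matrix.mulVecLin_apply, hr']; rfl
    rw [vecMulVec_mulVec, hx, MulOpposite.op_one, one_smul] at h5
    rw [h5] at hx
    simp at hx

theorem span_pr (x : ι → ℂ) : vecMulVec x (star x) ∈ Submodule.span ℂ (PureSet ι) := by
  by_cases hx : x = 0
  · subst hx; simp
  · obtain ⟨r, y, hr, hy, rfl⟩ := exists_unit x hx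
    rw [star_smul, smul_vecMulVec, vecMulVec_smul]
    exact Submodule.smul_mem _ _ (Submodule.smul_mem _ _ (Submodule.subset_span ⟨y, hy, rfl⟩))

theorem span_pure : Submodule.span ℂ (PureSet ι) = ⊤ := by
  rw [eq_top_iff]
  intro M _
  have key : ∀ x y : ι → ℂ, vecMulVec x (star y) ∈ Submodule.span ℂ (PureSet ι) := by
    intro x y
    have : vecMulVec x (star y) = (1/4:ℂ) • (vecMulVec (x+y) (star (x+y)) - vecMulVec (x-y) (star (x-y)))
      + (Complex.I/4) • (vecMulVec (x + Complex.I • y) (star (x+Complex.I • y)) - vecMulVec (x-Complex.I • y) (star (x-Complex.I • y))) := by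
      ext i j
      simp [vecMulVec_apply]
      ring_nf
      simp
      ring
    rw [this]
    exact Submodule.add_mem _ (Submodule.smul_mem _ _ (Submodule.sub_mem _ (span_pr _) (span_pr _)))
      (Submodule.smul_mem _ _ (Submodule.sub_mem _ (span_pr _) (span_pr _)))
  rw [Matrix.matrix_eq_sum_single M]
  refine Submodule.sum_mem _ fun i _ => Submodule.sum_mem _ fun j _ => ?_
  have : Matrix.single i j (M i j) = (M i j) • vecMulVec (Pi.single i 1) (star (Pi.single j 1)) := by
    ext k l
    simp [Matrix.single_apply, vecMulVec_apply, Pi.single_apply]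
    grind
  rw [this]
  exact Submodule.smul_mem _ _ (key _ _)

theorem lin_ext_pure {M : Type*} [AddCommGroup M] [Module ℂ M] (f g : Matrix ι ι ℂ →ₗ[ℂ] M)
    (h : ∀ P ∈ PureSet ι, f P = g P) : f = g :=
  LinearMap.ext_on span_pure h

/-- A linear map sending pure states to hermitian matrices preserves adjoints. -/
theorem lin_star (φ : Matrix ι ι ℂ →ₗ[ℂ] Matrix κ κ ℂ) (h : ∀ P ∈ PureSet ι, φ P ∈ PureSet κ)
    (M : Matrix ι ι ℂ) : φ Mᴴ = (φ M)ᴴ := by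
  have hM : M ∈ Submodule.span ℂ (PureSet ι) := by rw [span_pure]; trivial
  induction hM using Submodule.span_induction with
  | mem P hP => rw [pure_herm hP, pure_herm (h P hP)]
  | zero => simp
  | add x y _ _ hx hy => simp [hx, hy]
  | smul c x _ hx => simp [hx, conjTranspose_smul]

/-- overlap -/
theorem ov_real {P Q : Matrix ι ι ℂ} (hP : P ∈ PureSet ι) (hQ : Q ∈ PureSet ι) :
    ∃ r : ℝ, (P * Q).trace = r ∧ r ≤ 1 ∧ (r = 1 → P = Q) := by
  have h1 : star (P * Q).trace = (P * Q).trace := by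
    rw [← trace_conjTranspose, conjTranspose_mul, pure_herm hP, pure_herm hQ, trace_mul_comm]
  obtain ⟨r, hr⟩ := Complex.conj_eq_iff_real.1 h1
  have h2 : ((P - Q)ᴴ * (P - Q)).trace = ((2 - 2 * r : ℝ) : ℂ) := by
    rw [conjTranspose_sub, pure_herm hP, pure_herm hQ, sub_mul, mul_sub, mul_sub, pure_idem hP, pure_idem hQ]
    simp only [trace_sub, pure_trace hP, pure_trace hQ, trace_mul_comm Q P, hr]
    push_cast; ring
  refine ⟨r, hr, ?_, ?_⟩
  · have := (trace_star_mul_real _ _ h2).1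
    linarith
  · rintro rfl
    exact sub_eq_zero.1 ((trace_star_mul_real _ _ h2).2 (by norm_num))

theorem pure_sandwich {P : Matrix ι ι ℂ} (hP : P ∈ PureSet ι) (M : Matrix ι ι ℂ) :
    P * M * P = (P * M).trace • P := by
  obtain ⟨x, hx, rfl⟩ := hP
  rw [vecMulVec_mul, vecMulVec_mul_vecMulVec, trace_vecMulVec, dotProduct_comm, vecMulVec_smul]

/-- Four equations imply the local normal form. -/
theorem local_form {A B X Y : Matrix ι ι ℂ} (hA : A ∈ PureSet ι) (hB : B ∈ PureSet ι) (hAB : A ≠ B)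
    (hY : Y = Xᴴ) (e1 : A * X + X * A = X) (e2 : B * X + X * B = X) (e3 : X * X = 0)
    (e4 : A * B + B * A + X * Y + Y * X = A + B) :
    (A * X = X ∨ X * A = X) ∧ (A * X = X → Y * X = B) := by
  have dich : ∀ C ∈ PureSet ι, C * X + X * C = X → (C * X = X ∧ X * C = 0) ∨ (C * X = 0 ∧ X * C = X) := by
    intro C hC e
    have c1 : C * X * C = 0 := by
      have := congrArg (fun Z => C * Z) e
      simp only [mul_add, ← mul_assoc, pure_idem hC] at this
      simpa using this
    have c2 : X * C * X = 0 := by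
      have h := congrArg₂ (· * ·) e e
      simp only [e3] at h
      have : (C * X + X * C) * (C * X + X * C) = C * X * C * X + C * (X * X) * C + X * (C * C) * X + X * (C * X * C) := by
        noncomm_ring
      rw [this, c1, e3, pure_idem hC] at h
      simpa using h
    obtain ⟨x, hx, rfl⟩ := hC
    rw [mul_vecMulVec, vecMulVec_mul, vecMulVec_eq_zero] at c2
    rcases c2 with c | c
    · left
      have : X * vecMulVec x (star x) = 0 := by rw [mul_vecMulVec, c]; simp
      rw [this, add_zero] at e
      exact ⟨e, this⟩
    · right
      have : vecMulVec x (star x) * X = 0 := by rw [vecMulVec_mul, c]; simp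
      rw [this, zero_add] at e
      exact ⟨this, e⟩
  have dA := dich A hA e1
  have dB := dich B hB e2
  refine ⟨by tauto, fun hAX => ?_⟩
  obtain ⟨r, hr, -, hr1⟩ := ov_real hA hB
  have hne : (1 - r : ℂ) ≠ 0 := by
    intro h
    exact hAB (hr1 (by exact_mod_cast (sub_eq_zero.1 h).symm))
  have hXA : X * A = 0 := by
    rw [hAX] at e1; simpa using e1
  have hYA : Y * A = Y := by
    have := congrArg conjTranspose hAX
    rwa [conjTranspose_mul, pure_herm hA, ← hY] at this
  have hAY : A * Y = 0 := by
    have := congrArg conjTranspose hXA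
    rwa [conjTranspose_mul, pure_herm hA, ← hY, conjTranspose_zero] at this
  have sA : A * B * A = (r:ℂ) • A := by rw [pure_sandwich hA, hr]
  have sB : B * A * B = (r:ℂ) • B := by rw [pure_sandwich hB, trace_mul_comm, hr]
  have f1 : X * Y = (1 - r : ℂ) • A := by
    have := congrArg (fun Z => A * Z) e4
    simp only [mul_add, ← mul_assoc, pure_idem hA, hAX, hAY, zero_mul, sA, add_zero] at this
    linear_combination (norm := module) this
  rcases dB with ⟨b1, b2⟩ | ⟨b1, b2⟩
  · exfalso
    have hBY : B * Y = 0 := by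
      have := congrArg conjTranspose b2
      rwa [conjTranspose_mul, pure_herm hB, ← hY, conjTranspose_zero] at this
    have f2 : X * Y = (1 - r : ℂ) • B := by
      have := congrArg (fun Z => B * Z) e4
      simp only [mul_add, ← mul_assoc, pure_idem hB, b1, hBY, zero_mul, sB, add_zero] at this
      linear_combination (norm := module) this
    rw [f1] at f2
    exact hAB (smul_right_injective _ hne f2)
  · have hBY : B * Y = Y := by
      have := congrArg conjTranspose b2
      rwa [conjTranspose_mul, pure_herm hB, ← hY] at this
    have f2 : Y * X = (1 - r : ℂ) • B := by
      have := congrArg (fun Z => B * Z) e4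
      simp only [mul_add, ← mul_assoc, pure_idem hB, b1, hBY, zero_mul, sB, add_zero] at this
      linear_combination (norm := module) this
    have f3 : A * B = 0 := by
      rw [f1, f2] at e4
      have := congrArg (fun Z => A * Z) e4
      simp only [mul_add, ← mul_assoc, pure_idem hA, mul_smul_comm, sA] at this
      have h : (1 - r : ℂ) • (A * B) = 0 := by linear_combination (norm := module) this
      exact (smul_eq_zero.1 h).resolve_left hne
    have : (r:ℂ) = 0 := by rw [← hr, f3]; simp
    rw [f2, this]; simp
end

set_option linter.unusedSectionVars false
section
variable {ι κ : Type*} [Fintype ι] [DecidableEq ι] [Fintype κ] [DecidableEq κ]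

theorem pair_form (φ : Matrix ι ι ℂ →ₗ[ℂ] Matrix κ κ ℂ) (h : ∀ P ∈ PureSet ι, φ P ∈ PureSet κ)
    (hinj : Set.InjOn φ (PureSet ι)) (x y : ι → ℂ) (hx : star x ⬝ᵥ x = 1) (hy : star y ⬝ᵥ y = 1)
    (hxy : star x ⬝ᵥ y = 0) :
    (φ (vecMulVec x (star x)) * φ (vecMulVec x (star y)) = φ (vecMulVec x (star y)) ∨
     φ (vecMulVec x (star y)) * φ (vecMulVec x (star x)) = φ (vecMulVec x (star y))) ∧
    (φ (vecMulVec x (star x)) * φ (vecMulVec x (star y)) = φ (vecMulVec x (star y)) →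
     (φ (vecMulVec x (star y)))ᴴ * φ (vecMulVec x (star y)) = φ (vecMulVec y (star y))) := by
  have hyx : star y ⬝ᵥ x = 0 := by
    rw [star_dotProduct, hxy, star_zero]
  have pA : vecMulVec x (star x) ∈ PureSet ι := ⟨x, hx, rfl⟩
  have pB : vecMulVec y (star y) ∈ PureSet ι := ⟨y, hy, rfl⟩
  have hY : φ (vecMulVec y (star x)) = (φ (vecMulVec x (star y)))ᴴ := by
    rw [← lin_star φ h]; simp [conjTranspose_vecMulVec]
  have hne : φ (vecMulVec x (star x)) ≠ φ (vecMulVec y (star y)) := by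
    intro e
    have := hinj pA pB e
    have := congrArg (fun M => M *ᵥ x) this
    simp only [vecMulVec_mulVec, hx, hyx] at this
    simp at this
    rw [this] at hx; simp at hx
  have key := idem_fourier (φ (vecMulVec x (star x))) (φ (vecMulVec y (star y)))
    (φ (vecMulVec x (star y))) (φ (vecMulVec y (star x))) ?_ (pure_idem (h _ pA)) (pure_idem (h _ pB))
  · obtain ⟨e1, e2, e3, e4⟩ := key
    have := local_form (h _ pA) (h _ pB) hne hY e1 e2 e3 e4
    rw [hY] at this
    exact this
  · rintro c s t u ⟨h1, h2, h3⟩ ⟨rfl, h5⟩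
    have : (c*c) • φ (vecMulVec x (star x)) + (s*s) • φ (vecMulVec y (star y)) + (c*s) • (star t • φ (vecMulVec x (star y)) + t • φ (vecMulVec y (star x))) = 
        φ (vecMulVec (c • x + (s * t) • y) (star (c • x + (s * t) • y))) := by
      rw [← map_smul, ← map_smul, ← map_smul, ← map_smul, ← map_add, ← map_add, ← map_smul, ← map_add]
      congr 1
      simp only [star_add, star_smul, star_mul', h2, h3, vecMulVec_add, add_vecMulVec, smul_vecMulVec, vecMulVec_smul]
      match_scalars <;> first | ring1 | linear_combination (-s*s)*h5
    rw [this]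
    apply pure_idem
    apply h
    refine ⟨_, ?_, rfl⟩
    simp only [star_add, star_smul, star_mul', h2, h3, dotProduct_add, add_dotProduct, smul_dotProduct, dotProduct_smul, hx, hy, hxy, hyx, smul_eq_mul]
    linear_combination h1 + s * s * h5

theorem wigner_one (φ : Matrix ι ι ℂ →ₗ[ℂ] Matrix κ κ ℂ) (h : ∀ P ∈ PureSet ι, φ P ∈ PureSet κ)
    (hinj : Set.InjOn φ (PureSet ι)) (e : ι → ℂ) (he : star e ⬝ᵥ e = 1)
    (hone : ∀ x, star e ⬝ᵥ x = 0 → 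
      φ (vecMulVec e (star e)) * φ (vecMulVec e (star x)) = φ (vecMulVec e (star x))) :
    ∃ U : Matrix κ ι ℂ, Uᴴ * U = 1 ∧ ∀ X, φ X = U * X * Uᴴ := by
  have pA : φ (vecMulVec e (star e)) ∈ PureSet κ := h _ ⟨e, he, rfl⟩
  have hst := lin_star φ h
  -- the quadratic identity on the orthogonal complement
  have q1 : ∀ x, star e ⬝ᵥ x = 0 → 
      (φ (vecMulVec e (star x)))ᴴ * φ (vecMulVec e (star x)) = φ (vecMulVec x (star x)) := by
    intro x hx
    by_cases h0 : x = 0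
    · subst h0; simp
    obtain ⟨r, y, hr, hy, rfl⟩ := exists_unit x h0
    have hr0 : (r : ℂ) ≠ 0 := by exact_mod_cast hr.ne'
    have hey : star e ⬝ᵥ y = 0 := by
      rw [dotProduct_smul] at hx
      exact (smul_eq_zero.1 hx).resolve_left hr0
    have := (pair_form φ h hinj e y he hy hey).2 (hone y hey)
    simp only [star_smul, vecMulVec_smul, smul_vecMulVec, map_smul, conjTranspose_smul, smul_mul_assoc, mul_smul_comm, this]
    simp [smul_smul]
  have dec : ∀ x : ι → ℂ, ∃ (c : ℂ) (y : ι → ℂ), star e ⬝ᵥ y = 0 ∧ x = c • e + y := by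
    intro x
    refine ⟨star e ⬝ᵥ x, x - (star e ⬝ᵥ x) • e, ?_, by simp⟩
    rw [dotProduct_sub, dotProduct_smul, he]; simp
  have hone' : ∀ x, φ (vecMulVec e (star e)) * φ (vecMulVec e (star x)) = φ (vecMulVec e (star x)) := by
    intro x
    obtain ⟨c, y, hy, rfl⟩ := dec x
    simp only [star_add, star_smul, vecMulVec_add, vecMulVec_smul, map_add, map_smul, mul_add, mul_smul_comm, hone y hy, pure_idem pA]
  have q2 : ∀ x, (φ (vecMulVec e (star x)))ᴴ * φ (vecMulVec e (star x)) = φ (vecMulVec x (star x)) := by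
    intro x
    obtain ⟨c, y, hy, rfl⟩ := dec x
    have a1 := hone y hy
    have a2 := congrArg conjTranspose a1
    rw [conjTranspose_mul, pure_herm pA] at a2
    have a3 : φ (vecMulVec y (star e)) = (φ (vecMulVec e (star y)))ᴴ := by
      rw [← hst]; simp [conjTranspose_vecMulVec]
    simp only [star_add, star_smul, vecMulVec_add, add_vecMulVec, smul_vecMulVec, vecMulVec_smul, map_add, map_smul,
      mul_add, add_mul, mul_smul_comm, smul_mul_assoc, conjTranspose_add, conjTranspose_smul, pure_herm pA, pure_idem pA, a1, a2, q1 y hy, a3, star_star]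
  obtain ⟨a, ha, hA⟩ := pA
  let L : (ι → ℂ) →ₗ[ℂ] (κ → ℂ) :=
    { toFun := fun x => φ (vecMulVec x (star e)) *ᵥ a
      map_add' := fun x y => by simp [add_vecMulVec, add_mulVec]
      map_smul' := fun c x => by simp [smul_vecMulVec, smul_mulVec] }
  let U : Matrix κ ι ℂ := LinearMap.toMatrix' L
  have hU : ∀ x, U *ᵥ x = φ (vecMulVec x (star e)) *ᵥ a := fun x => by
    simp only [U, LinearMap.toMatrix'_mulVec]; rfl
  have hX : ∀ x, φ (vecMulVec e (star x)) = vecMulVec a (star (U *ᵥ x)) := by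
    intro x
    rw [← hone' x, hA, vecMulVec_mul, hU, star_mulVec, ← hst, conjTranspose_vecMulVec, star_star]
  have hφ : ∀ X, φ X = U * X * Uᴴ := by
    let ψ : Matrix ι ι ℂ →ₗ[ℂ] Matrix κ κ ℂ :=
      { toFun := fun X => U * X * Uᴴ
        map_add' := fun x y => by rw [Matrix.mul_add, Matrix.add_mul]
        map_smul' := fun c x => by simp }
    have : φ = ψ := by
      apply lin_ext_pure
      rintro P ⟨x, hx, rfl⟩
      rw [← q2 x, hX x, conjTranspose_vecMulVec, star_star, vecMulVec_mul_vecMulVec, ha, one_smul]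
      simp only [ψ, LinearMap.coe_mk, AddHom.coe_mk]
      rw [mul_vecMulVec, vecMulVec_mul, star_mulVec]
    intro X
    rw [this]; rfl
  refine ⟨U, ?_, hφ⟩
  let t1 : Matrix ι ι ℂ →ₗ[ℂ] ℂ :=
    { toFun := fun X => (Uᴴ * U * X).trace
      map_add' := fun x y => by simp [mul_add]
      map_smul' := fun c x => by simp }
  have ht : t1 = Matrix.traceLinearMap ι ℂ ℂ := by
    apply lin_ext_pure
    intro P hP
    have h2 := pure_trace (h P hP)
    rw [hφ, Matrix.mul_assoc, trace_mul_comm, Matrix.mul_assoc] at h2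
    simp only [t1, LinearMap.coe_mk, AddHom.coe_mk, traceLinearMap_apply, pure_trace hP]
    rw [trace_mul_comm, ← h2]
  apply Matrix.ext_iff_trace_mul_right.2
  intro X
  have := congrArg (fun f => f X) ht
  simpa [t1] using this

theorem pure_transpose {P : Matrix ι ι ℂ} (hP : P ∈ PureSet ι) : Pᵀ ∈ PureSet ι := by
  obtain ⟨x, hx, rfl⟩ := hP
  refine ⟨star x, ?_, by rw [transpose_vecMulVec, star_star]⟩
  rw [star_star, dotProduct_comm, hx]

theorem wigner [Nonempty ι] (φ : Matrix ι ι ℂ →ₗ[ℂ] Matrix κ κ ℂ) (h : ∀ P ∈ PureSet ι, φ P ∈ PureSet κ)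
    (hinj : Set.InjOn φ (PureSet ι)) :
    ∃ U : Matrix κ ι ℂ, Uᴴ * U = 1 ∧ ((∀ X, φ X = U * X * Uᴴ) ∨ (∀ X, φ X = U * Xᵀ * Uᴴ)) := by
  obtain ⟨i0⟩ := ‹Nonempty ι›
  let e : ι → ℂ := Pi.single i0 1
  have hse : star e = e := by
    simp only [e]; ext i; by_cases hi : i = i0 <;> simp [hi]
  have he : star e ⬝ᵥ e = 1 := by rw [hse]; simp [e]
  have dich : ∀ x, star e ⬝ᵥ x = 0 → 
     (φ (vecMulVec e (star e)) * φ (vecMulVec e (star x)) = φ (vecMulVec e (star x)) ∨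
     φ (vecMulVec e (star x)) * φ (vecMulVec e (star e)) = φ (vecMulVec e (star x))) := by
    intro x hx
    by_cases h0 : x = 0
    · subst h0; simp
    obtain ⟨r, y, hr, hy, rfl⟩ := exists_unit x h0
    have hr0 : (r : ℂ) ≠ 0 := by exact_mod_cast hr.ne'
    have hey : star e ⬝ᵥ y = 0 := by
      rw [dotProduct_smul] at hx
      exact (smul_eq_zero.1 hx).resolve_left hr0
    have := (pair_form φ h hinj e y he hy hey).1
    simp only [star_smul, vecMulVec_smul, map_smul, smul_mul_assoc, mul_smul_comm]
    rcases this with h | h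
    · left; rw [h]
    · right; rw [h]
  have glob : (∀ x, star e ⬝ᵥ x = 0 → φ (vecMulVec e (star e)) * φ (vecMulVec e (star x)) = φ (vecMulVec e (star x))) ∨
     (∀ x, star e ⬝ᵥ x = 0 → φ (vecMulVec e (star x)) * φ (vecMulVec e (star e)) = φ (vecMulVec e (star x))) := by
    by_contra! hc
    obtain ⟨⟨x, hx, hx'⟩, ⟨y, hy, hy'⟩⟩ := hc
    have x2 := (dich x hx).resolve_left hx'
    have y2 := (dich y hy).resolve_right hy'
    rcases dich (x + y) (by rw [dotProduct_add, hx, hy, add_zero]) with k | k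
    · simp only [star_add, vecMulVec_add, map_add, mul_add, y2] at k
      exact hx' (add_right_cancel k)
    · simp only [star_add, vecMulVec_add, map_add, add_mul, x2] at k
      exact hy' (add_left_cancel k)
  rcases glob with g | g
  · obtain ⟨U, hU, hφ⟩ := wigner_one φ h hinj e he g
    exact ⟨U, hU, Or.inl hφ⟩
  · let φ' : Matrix ι ι ℂ →ₗ[ℂ] Matrix κ κ ℂ := φ ∘ₗ (Matrix.transposeLinearEquiv ι ι ℂ ℂ).toLinearMap
    have hφ' : ∀ X, φ' X = φ Xᵀ := fun X => rfl
    have hg : ∀ x, star e ⬝ᵥ x = 0 →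
        φ' (vecMulVec e (star e)) * φ' (vecMulVec e (star x)) = φ' (vecMulVec e (star x)) := by
      intro x hx
      have hx' : star e ⬝ᵥ star x = 0 := by
        have := congrArg star hx
        rw [star_dotProduct, star_star, star_zero, dotProduct_comm] at this
        rw [hse]; exact this
      have := g (star x) hx'
      have := congrArg conjTranspose this
      rw [conjTranspose_mul, ← lin_star φ h, ← lin_star φ h, conjTranspose_vecMulVec, conjTranspose_vecMulVec] at this
      simp only [star_star, hse] at this
      rw [hφ', hφ', transpose_vecMulVec, transpose_vecMulVec, hse, this]
    obtain ⟨U, hU, hφ⟩ := wigner_one φ' (fun P hP => h _ (pure_transpose hP))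
      (fun P hP Q hQ hPQ => transpose_injective (hinj (pure_transpose hP) (pure_transpose hQ) hPQ)) e he hg
    exact ⟨U, hU, Or.inr fun X => by rw [← hφ, hφ', transpose_transpose]⟩
end

set_option linter.unusedSectionVars false
section
variable {ι κ ι' κ' : Type*} [Fintype ι] [DecidableEq ι] [Fintype κ] [DecidableEq κ]
  [Fintype ι'] [DecidableEq ι'] [Fintype κ'] [DecidableEq κ']

def ptr₂ : Matrix (ι × κ) (ι × κ) ℂ →ₗ[ℂ] Matrix ι ι ℂ where
  toFun M := Matrix.of fun i j => ∑ k, M (i, k) (j, k)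
  map_add' x y := by ext; simp [Finset.sum_add_distrib]
  map_smul' c x := by ext; simp [Finset.mul_sum]

/-- Partial trace over the first factor. -/
def ptr₁ : Matrix (ι × κ) (ι × κ) ℂ →ₗ[ℂ] Matrix κ κ ℂ where
  toFun M := Matrix.of fun i j => ∑ k, M (k, i) (k, j)
  map_add' x y := by ext; simp [Finset.sum_add_distrib]
  map_smul' c x := by ext; simp [Finset.mul_sum]

theorem ptr₂_kron (A : Matrix ι ι ℂ) (B : Matrix κ κ ℂ) : ptr₂ (A ⊗ₖ B) = B.trace • A := by
  ext i j
  simp [ptr₂, Matrix.trace, ← Finset.mul_sum, mul_comm]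

theorem ptr₁_kron (A : Matrix ι ι ℂ) (B : Matrix κ κ ℂ) : ptr₁ (A ⊗ₖ B) = A.trace • B := by
  ext i j
  simp [ptr₁, Matrix.trace, ← Finset.sum_mul]

theorem kron_inj {P P' : Matrix ι ι ℂ} {Q Q' : Matrix κ κ ℂ} (hP : P ∈ PureSet ι) (hP' : P' ∈ PureSet ι)
    (hQ : Q ∈ PureSet κ) (hQ' : Q' ∈ PureSet κ) (h : P ⊗ₖ Q = P' ⊗ₖ Q') : P = P' ∧ Q = Q' := by
  have h1 := congrArg ptr₁ h
  have h2 := congrArg ptr₂ h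
  simp only [ptr₁_kron, ptr₂_kron, pure_trace hP, pure_trace hP', pure_trace hQ, pure_trace hQ', one_smul] at h1 h2
  exact ⟨h2, h1⟩

/-- Tensoring with a fixed right factor. -/
def kronR (B : Matrix κ κ ℂ) : Matrix ι ι ℂ →ₗ[ℂ] Matrix (ι × κ) (ι × κ) ℂ where
  toFun A := A ⊗ₖ B
  map_add' _ _ := add_kronecker _ _ _
  map_smul' _ _ := smul_kronecker _ _ _

/-- Tensoring with a fixed left factor. -/
def kronL (A : Matrix ι ι ℂ) : Matrix κ κ ℂ →ₗ[ℂ] Matrix (ι × κ) (ι × κ) ℂ where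
  toFun B := A ⊗ₖ B
  map_add' _ _ := kronecker_add _ _ _
  map_smul' _ _ := kronecker_smul _ _ _

/-- The pure product states. -/
def PPSet (ι κ : Type*) [Fintype ι] [Fintype κ] : Set (Matrix (ι × κ) (ι × κ) ℂ) :=
  {C | ∃ P ∈ PureSet ι, ∃ Q ∈ PureSet κ, C = P ⊗ₖ Q}

theorem span_PP : Submodule.span ℂ (PPSet ι κ) = ⊤ := by
  have h1 : ∀ (A : Matrix ι ι ℂ) (B : Matrix κ κ ℂ), A ⊗ₖ B ∈ Submodule.span ℂ (PPSet ι κ) := by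
    intro A B
    have hA : A ∈ Submodule.span ℂ (PureSet ι) := by rw [span_pure]; trivial
    have hB : B ∈ Submodule.span ℂ (PureSet κ) := by rw [span_pure]; trivial
    induction hA using Submodule.span_induction with
    | mem P hP =>
      induction hB using Submodule.span_induction with
      | mem Q hQ => exact Submodule.subset_span ⟨P, hP, Q, hQ, rfl⟩
      | zero => simp
      | add x y _ _ hx hy => rw [kronecker_add]; exact Submodule.add_mem _ hx hy
      | smul c x _ hx => rw [kronecker_smul]; exact Submodule.smul_mem _ _ hx
    | zero => simp
    | add x y _ _ hx hy => rw [add_kronecker]; exact Submodule.add_mem _ hx hy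
    | smul c x _ hx => rw [smul_kronecker]; exact Submodule.smul_mem _ _ hx
  rw [eq_top_iff]
  intro M _
  rw [Matrix.matrix_eq_sum_single M]
  refine Submodule.sum_mem _ fun i _ => Submodule.sum_mem _ fun j _ => ?_
  have : Matrix.single i j (M i j) = (M i j) • ((Matrix.single i.1 j.1 (1:ℂ)) ⊗ₖ (Matrix.single i.2 j.2 (1:ℂ))) := by
    rw [Matrix.single_kronecker_single]
    simp
  rw [this]
  exact Submodule.smul_mem _ _ (h1 _ _)

/-- Two distinct pure states have another decomposition of their sum. -/
theorem pure_split {P Q : Matrix ι ι ℂ} (hP : P ∈ PureSet ι) (hQ : Q ∈ PureSet ι) (hne : P ≠ Q) :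
    ∃ R ∈ PureSet ι, ∃ R' ∈ PureSet ι, P + Q = R + R' ∧ R ≠ P ∧ R ≠ Q := by
  obtain ⟨x, hx, rfl⟩ := hP
  obtain ⟨y, hy, rfl⟩ := hQ
  -- choose the phase of y
  obtain ⟨y', hy', hyy, hre⟩ : ∃ y' : ι → ℂ, star y' ⬝ᵥ y' = 1 ∧
      vecMulVec y (star y) = vecMulVec y' (star y') ∧ star x ⬝ᵥ y' + star y' ⬝ᵥ x = 0 := by
    have : ∃ u : ℂ, star u * u = 1 ∧ u * (star x ⬝ᵥ y) + star u * star (star x ⬝ᵥ y) = 0 := by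
      generalize star x ⬝ᵥ y = z
      by_cases hz : z = 0
      · exact ⟨1, by simp, by simp [hz]⟩
      · have hn : (‖z‖ : ℂ) ≠ 0 := by exact_mod_cast (norm_pos_iff.2 hz).ne'
        have hz2 : star z * z = ‖z‖ ^ 2 := by rw [Complex.star_def, Complex.conj_mul']
        refine ⟨Complex.I * star z / ‖z‖, ?_, ?_⟩
        · simp only [star_div₀, star_mul', Complex.star_def, Complex.conj_I, Complex.conj_conj, Complex.conj_ofReal]
          rw [Complex.star_def] at hz2
          field_simp
          linear_combination hz2 - (starRingEnd ℂ z * z) * Complex.I_sq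
        · simp only [star_div₀, star_mul', Complex.star_def, Complex.conj_I, Complex.conj_conj, Complex.conj_ofReal]
          ring
    obtain ⟨u, hu, hu2⟩ := this
    refine ⟨u • y, ?_, ?_, ?_⟩
    · rw [star_smul, smul_dotProduct, dotProduct_smul, hy]; simpa using hu
    · rw [star_smul, vecMulVec_smul, smul_vecMulVec, smul_smul, hu, one_smul]
    · rw [star_dotProduct (u • y) x, dotProduct_smul, smul_eq_mul, star_mul']
      exact hu2
  rw [hyy] at hne ⊢
  clear hyy hy y
  let s : ℂ := ((Real.sqrt 2)⁻¹ : ℝ)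
  have hs : star s = s := by simp [s]
  have hss : s * s = 1/2 := by
    have : (Real.sqrt 2)⁻¹ * (Real.sqrt 2)⁻¹ = 1/2 := by
      rw [← mul_inv, Real.mul_self_sqrt (by norm_num)]; norm_num
    simp only [s]; rw [← Complex.ofReal_mul, this]; norm_num
  have hs0 : s ≠ 0 := by intro h; rw [h] at hss; norm_num at hss
  -- proportional vectors
  have prop : ∀ a b : ι → ℂ, star a ⬝ᵥ a = 1 → ∀ v w : ι → ℂ, ∀ c : ℂ, star v ⬝ᵥ v = 1 → star w ⬝ᵥ w = 1 → w = c • v → 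
      vecMulVec v (star v) = vecMulVec w (star w) := by
    rintro - - - v w c hv hw rfl
    rw [star_smul, smul_dotProduct, dotProduct_smul, hv] at hw
    rw [star_smul, vecMulVec_smul, smul_vecMulVec, smul_smul, show star c * c = 1 by simpa using hw, one_smul]
  have eig : ∀ a b : ι → ℂ, star b ⬝ᵥ b = 1 → vecMulVec a (star a) = vecMulVec b (star b) → ∃ c : ℂ, b = c • a := by
    intro a b hb h
    have := congrArg (fun M => M *ᵥ b) h
    simp only [vecMulVec_mulVec, hb] at this
    exact ⟨star a ⬝ᵥ b, by simpa using this.symm⟩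
  refine ⟨vecMulVec (s • (x + y')) (star (s • (x + y'))), ⟨_, ?_, rfl⟩, 
    vecMulVec (s • (x - y')) (star (s • (x - y'))), ⟨_, ?_, rfl⟩, ?_, ?_, ?_⟩
  · simp only [star_smul, star_add, smul_dotProduct, dotProduct_smul, dotProduct_add, add_dotProduct, hx, hy', hs, smul_eq_mul]
    linear_combination (2 + (star x ⬝ᵥ y' + star y' ⬝ᵥ x)) * hss + (1/2) * hre
  · simp only [star_smul, star_sub, smul_dotProduct, dotProduct_smul, dotProduct_sub, sub_dotProduct, hx, hy', hs, smul_eq_mul]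
    linear_combination (2 - (star x ⬝ᵥ y' + star y' ⬝ᵥ x)) * hss - (1/2) * hre
  · ext i j
    simp only [vecMulVec_apply, Matrix.add_apply, Pi.star_apply, Pi.smul_apply, Pi.add_apply, Pi.sub_apply, smul_eq_mul, star_mul', star_add, star_sub, hs]
    linear_combination (-2 * (x i * star (x j) + y' i * star (y' j))) * hss
  · intro h
    obtain ⟨c, hc⟩ := eig _ _ hx h
    have hcs : c * s ≠ 0 := by
      intro h0; rw [smul_smul, h0, zero_smul] at hc; rw [hc] at hx; simp at hx
    apply hne
    apply prop x x hx x y' ((c * s)⁻¹ - 1) hx hy'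
    rw [sub_smul, one_smul]
    nth_rewrite 1 [hc]
    rw [smul_smul, smul_smul, mul_assoc, inv_mul_cancel₀ hcs, one_smul]; simp
  · intro h
    obtain ⟨c, hc⟩ := eig _ _ hy' h
    have hcs : c * s ≠ 0 := by
      intro h0; rw [smul_smul, h0, zero_smul] at hc; rw [hc] at hy'; simp at hy'
    apply hne
    symm
    apply prop x x hx y' x ((c * s)⁻¹ - 1) hy' hx
    rw [sub_smul, one_smul]
    nth_rewrite 1 [hc]
    rw [smul_smul, smul_smul, mul_assoc, inv_mul_cancel₀ hcs, one_smul]; simp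

/-- If neither factor is shared, the sum of two product states decomposes uniquely. -/
theorem prod_unique {P P' R R' : Matrix ι ι ℂ} {Q Q' S S' : Matrix κ κ ℂ}
    (hP : P ∈ PureSet ι) (hP' : P' ∈ PureSet ι) (hR : R ∈ PureSet ι) (hR' : R' ∈ PureSet ι)
    (hQ : Q ∈ PureSet κ) (hQ' : Q' ∈ PureSet κ) (hS : S ∈ PureSet κ) (hS' : S' ∈ PureSet κ)
    (h : P ⊗ₖ Q + P' ⊗ₖ Q' = R ⊗ₖ S + R' ⊗ₖ S') : R = P ∨ S = Q' := by
  have key := congrArg (fun M => (((1 - P) ⊗ₖ (1 - Q')) * M).trace) h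
  simp only [mul_add, ← Matrix.mul_kronecker_mul, trace_add, trace_kronecker, sub_mul, one_mul, pure_idem hP, pure_idem hQ',
    sub_self, trace_zero, zero_mul, mul_zero, add_zero, trace_sub, pure_trace hR, pure_trace hS, pure_trace hR', pure_trace hS'] at key
  obtain ⟨a, ha, ha1, ha2⟩ := ov_real hP hR
  obtain ⟨b, hb, hb1, hb2⟩ := ov_real hQ' hS
  obtain ⟨c, hc, hc1, hc2⟩ := ov_real hP hR'
  obtain ⟨d, hd, hd1, hd2⟩ := ov_real hQ' hS'
  rw [ha, hb, hc, hd] at key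
  have key' : 0 = (1 - a) * (1 - b) + (1 - c) * (1 - d) := by
    have : (0:ℂ) = (1 - a) * (1 - b) + (1 - c) * (1 - d) := by linear_combination key
    exact_mod_cast this
  have k1 : 0 ≤ (1 - a) * (1 - b) := mul_nonneg (by linarith) (by linarith)
  have k2 : 0 ≤ (1 - c) * (1 - d) := mul_nonneg (by linarith) (by linarith)
  have k3 : (1 - a) * (1 - b) = 0 := by linarith
  rcases mul_eq_zero.1 k3 with k | k
  · left; exact (ha2 (by linarith)).symm
  · right; exact (hb2 (by linarith)).symm

theorem prod_share {P P' R R' : Matrix ι ι ℂ} {Q Q' S S' : Matrix κ κ ℂ}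
    (hP : P ∈ PureSet ι) (hP' : P' ∈ PureSet ι) (hR : R ∈ PureSet ι) (hR' : R' ∈ PureSet ι)
    (hQ : Q ∈ PureSet κ) (hQ' : Q' ∈ PureSet κ) (hS : S ∈ PureSet κ) (hS' : S' ∈ PureSet κ)
    (h : P ⊗ₖ Q + P' ⊗ₖ Q' = R ⊗ₖ S + R' ⊗ₖ S') (h1 : R ⊗ₖ S ≠ P ⊗ₖ Q) (h2 : R ⊗ₖ S ≠ P' ⊗ₖ Q') :
    P = P' ∨ Q = Q' := by
  have a := prod_unique hP hP' hR hR' hQ hQ' hS hS' h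
  have b := prod_unique hP' hP hR hR' hQ' hQ hS hS' (by rw [add_comm, h])
  rcases a with rfl | rfl <;> rcases b with rfl | rfl <;> simp_all
end

set_option linter.unusedSectionVars false
section
variable {ι κ ι' κ' : Type*} [Fintype ι] [DecidableEq ι] [Fintype κ] [DecidableEq κ]
  [Fintype ι'] [DecidableEq ι'] [Fintype κ'] [DecidableEq κ']

def tp (p : PureSet ι × PureSet κ) : Matrix (ι × κ) (ι × κ) ℂ := p.1.1 ⊗ₖ p.2.1

theorem tp_inj : Function.Injective (tp : PureSet ι × PureSet κ → _) := by
  rintro ⟨⟨P, hP⟩, ⟨Q, hQ⟩⟩ ⟨⟨P', hP'⟩, ⟨Q', hQ'⟩⟩ h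
  obtain ⟨rfl, rfl⟩ := kron_inj hP hP' hQ hQ' h
  rfl

theorem share_pres (Φ : Matrix (ι × κ) (ι × κ) ℂ →ₗ[ℂ] Matrix (ι × κ) (ι × κ) ℂ)
    (hinj : Function.Injective Φ) (F : PureSet ι × PureSet κ → PureSet ι × PureSet κ)
    (hF : ∀ p, tp (F p) = Φ (tp p)) (p q : PureSet ι × PureSet κ) (h : p.1 = q.1 ∨ p.2 = q.2) :
    (F p).1 = (F q).1 ∨ (F p).2 = (F q).2 := by
  by_cases hpq : p = q
  · subst hpq; simp
  have : ∃ r r' : PureSet ι × PureSet κ, tp p + tp q = tp r + tp r' ∧ r ≠ p ∧ r ≠ q := by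
    obtain ⟨⟨P, hP⟩, ⟨Q, hQ⟩⟩ := p
    obtain ⟨⟨P', hP'⟩, ⟨Q', hQ'⟩⟩ := q
    simp only [Subtype.mk.injEq] at h
    rcases h with rfl | rfl
    · obtain ⟨R, hR, R', hR', e, n1, n2⟩ := pure_split hQ hQ' (by rintro rfl; exact hpq rfl)
      refine ⟨(⟨P, hP⟩, ⟨R, hR⟩), (⟨P, hP⟩, ⟨R', hR'⟩), ?_, ?_, ?_⟩
      · simp only [tp, ← kronecker_add, e]
      · simpa using n1
      · simpa using n2
    · obtain ⟨R, hR, R', hR', e, n1, n2⟩ := pure_split hP hP' (by rintro rfl; exact hpq rfl)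
      refine ⟨(⟨R, hR⟩, ⟨Q, hQ⟩), (⟨R', hR'⟩, ⟨Q, hQ⟩), ?_, ?_, ?_⟩
      · simp only [tp, ← add_kronecker, e]
      · simpa using n1
      · simpa using n2
  obtain ⟨r, r', e, n1, n2⟩ := this
  have e' := congrArg Φ e
  rw [map_add, map_add, ← hF, ← hF, ← hF, ← hF] at e'
  have m : ∀ q, r ≠ q → tp (F r) ≠ tp (F q) := by
    intro q hrq h
    rw [hF, hF] at h
    exact hrq (tp_inj (hinj h))
  have := prod_share (F p).1.2 (F q).1.2 (F r).1.2 (F r').1.2 (F p).2.2 (F q).2.2 (F r).2.2 (F r').2.2 e'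
    (m p n1) (m q n2)
  simpa only [Subtype.ext_iff] using this

theorem pure_nontrivial [Nontrivial ι] : Nontrivial (PureSet ι) := by
  obtain ⟨i, j, hij⟩ := exists_pair_ne ι
  refine ⟨⟨_, ⟨Pi.single i 1, by simp, rfl⟩⟩, ⟨_, ⟨Pi.single j 1, by simp, rfl⟩⟩, ?_⟩
  intro h
  have := congrFun (congrFun (congrArg Subtype.val h) i) i
  simp [vecMulVec_apply, hij] at this

theorem factor_pure [Nontrivial ι] [Nontrivial κ]
    (Φ : Matrix (ι × κ) (ι × κ) ℂ →ₗ[ℂ] Matrix (ι × κ) (ι × κ) ℂ)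
    (h : Φ '' PPSet ι κ = PPSet ι κ) :
    (∃ (f : PureSet ι → PureSet ι) (g : PureSet κ → PureSet κ), f.Injective ∧ g.Injective ∧
      ∀ P Q, Φ (P.1 ⊗ₖ Q.1) = (f P).1 ⊗ₖ (g Q).1) ∨
    (∃ (f : PureSet ι → PureSet κ) (g : PureSet κ → PureSet ι), f.Injective ∧ g.Injective ∧
      ∀ P Q, Φ (P.1 ⊗ₖ Q.1) = (g Q).1 ⊗ₖ (f P).1) := by
  have hsurj : Function.Surjective Φ := by
    rw [← LinearMap.range_eq_top, eq_top_iff, ← span_PP, Submodule.span_le]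
    rw [← h]
    rintro _ ⟨x, -, rfl⟩
    exact ⟨x, rfl⟩
  have hinj : Function.Injective Φ := LinearMap.injective_iff_surjective.2 hsurj
  have ex : ∀ p : PureSet ι × PureSet κ, ∃ q : PureSet ι × PureSet κ, tp q = Φ (tp p) := by
    intro p
    have : Φ (tp p) ∈ PPSet ι κ := by
      rw [← h]; exact ⟨_, ⟨_, p.1.2, _, p.2.2, rfl⟩, rfl⟩
    obtain ⟨P, hP, Q, hQ, e⟩ := this
    exact ⟨(⟨P, hP⟩, ⟨Q, hQ⟩), e.symm⟩
  choose F0 hF0 using ex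
  have bij : Function.Bijective F0 := by
    constructor
    · intro p q hpq
      have := congrArg tp hpq
      rw [hF0, hF0] at this
      exact tp_inj (hinj this)
    · intro q
      have : tp q ∈ Φ '' PPSet ι κ := by
        rw [h]; exact ⟨_, q.1.2, _, q.2.2, rfl⟩
      obtain ⟨_, ⟨P, hP, Q, hQ, rfl⟩, e⟩ := this
      refine ⟨(⟨P, hP⟩, ⟨Q, hQ⟩), tp_inj ?_⟩
      rw [hF0]; exact e
  let F := Equiv.ofBijective F0 bij
  have hF : ∀ p, tp (F p) = Φ (tp p) := hF0
  let Φe := LinearEquiv.ofBijective Φ ⟨hinj, hsurj⟩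
  have hFs : ∀ p, tp (F.symm p) = Φe.symm.toLinearMap (tp p) := by
    intro p
    apply hinj
    rw [← hF, Equiv.apply_symm_apply]
    exact (Φe.apply_symm_apply (tp p)).symm
  haveI : Nontrivial (PureSet ι) := pure_nontrivial
  haveI : Nontrivial (PureSet κ) := pure_nontrivial
  obtain ⟨P0, -, -⟩ := exists_pair_ne (PureSet ι)
  obtain ⟨Q0, -, -⟩ := exists_pair_ne (PureSet κ)
  rcases grid_main F (share_pres Φ hinj F hF) (share_pres Φe.symm.toLinearMap Φe.symm.injective F.symm hFs) with
    ⟨f, g, hfg⟩ | ⟨f, g, hfg⟩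
  · left
    refine ⟨f, g, ?_, ?_, ?_⟩
    · intro P P' e
      have : F (P, Q0) = F (P', Q0) := by rw [hfg, hfg, e]
      exact congrArg Prod.fst (F.injective this)
    · intro P P' e
      have : F (P0, P) = F (P0, P') := by rw [hfg, hfg, e]
      exact congrArg Prod.snd (F.injective this)
    · intro P Q
      have := hF (P, Q)
      rw [hfg] at this
      exact this.symm
  · right
    refine ⟨f, g, ?_, ?_, ?_⟩
    · intro P P' e
      have : F (P, Q0) = F (P', Q0) := by rw [hfg, hfg, e]
      exact congrArg Prod.fst (F.injective this)
    · intro P P' e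
      have : F (P0, P) = F (P0, P') := by rw [hfg, hfg, e]
      exact congrArg Prod.snd (F.injective this)
    · intro P Q
      have := hF (P, Q)
      rw [hfg] at this
      exact this.symm

theorem factor_linear [Nontrivial ι] [Nontrivial κ]
    (Φ : Matrix (ι × κ) (ι × κ) ℂ →ₗ[ℂ] Matrix (ι' × κ') (ι' × κ') ℂ)
    (f : PureSet ι → PureSet ι') (g : PureSet κ → PureSet κ') (hf : f.Injective) (hg : g.Injective)
    (h : ∀ P Q, Φ (P.1 ⊗ₖ Q.1) = (f P).1 ⊗ₖ (g Q).1) :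
    ∃ (U : Matrix ι' ι ℂ) (V : Matrix κ' κ ℂ) (ψ₁ : Matrix ι ι ℂ → Matrix ι' ι' ℂ)
        (ψ₂ : Matrix κ κ ℂ → Matrix κ' κ' ℂ), Uᴴ * U = 1 ∧ Vᴴ * V = 1 ∧
        ((∀ X, ψ₁ X = U * X * Uᴴ) ∨ (∀ X, ψ₁ X = U * Xᵀ * Uᴴ)) ∧
        ((∀ X, ψ₂ X = V * X * Vᴴ) ∨ (∀ X, ψ₂ X = V * Xᵀ * Vᴴ)) ∧
        ∀ A B, Φ (A ⊗ₖ B) = ψ₁ A ⊗ₖ ψ₂ B := by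
  haveI : Nontrivial (PureSet ι) := pure_nontrivial
  haveI : Nontrivial (PureSet κ) := pure_nontrivial
  obtain ⟨P0, -, -⟩ := exists_pair_ne (PureSet ι)
  obtain ⟨Q0, -, -⟩ := exists_pair_ne (PureSet κ)
  let φ₁ : Matrix ι ι ℂ →ₗ[ℂ] Matrix ι' ι' ℂ := ptr₂ ∘ₗ Φ ∘ₗ kronR Q0.1
  let φ₂ : Matrix κ κ ℂ →ₗ[ℂ] Matrix κ' κ' ℂ := ptr₁ ∘ₗ Φ ∘ₗ kronL P0.1
  have h1 : ∀ P : PureSet ι, φ₁ P.1 = (f P).1 := by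
    intro P
    show ptr₂ (Φ (P.1 ⊗ₖ Q0.1)) = _
    rw [h, ptr₂_kron, pure_trace (g Q0).2, one_smul]
  have h2 : ∀ Q : PureSet κ, φ₂ Q.1 = (g Q).1 := by
    intro P
    show ptr₁ (Φ (P0.1 ⊗ₖ P.1)) = _
    rw [h, ptr₁_kron, pure_trace (f P0).2, one_smul]
  obtain ⟨U, hU, hU'⟩ := wigner φ₁ (fun P hP => by rw [h1 ⟨P, hP⟩]; exact (f _).2)
    (fun P hP P' hP' e => by
      rw [h1 ⟨P, hP⟩, h1 ⟨P', hP'⟩] at e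
      exact congrArg Subtype.val (hf (Subtype.ext e)))
  obtain ⟨V, hV, hV'⟩ := wigner φ₂ (fun P hP => by rw [h2 ⟨P, hP⟩]; exact (g _).2)
    (fun P hP P' hP' e => by
      rw [h2 ⟨P, hP⟩, h2 ⟨P', hP'⟩] at e
      exact congrArg Subtype.val (hg (Subtype.ext e)))
  refine ⟨U, V, φ₁, φ₂, hU, hV, hU', hV', ?_⟩
  intro A B
  have s1 : ∀ Q : PureSet κ, Φ ∘ₗ kronR Q.1 = kronR (φ₂ Q.1) ∘ₗ φ₁ := by
    intro Q
    apply lin_ext_pure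
    intro P hP
    show Φ (P ⊗ₖ Q.1) = (φ₁ P) ⊗ₖ (φ₂ Q.1)
    rw [h1 ⟨P, hP⟩, h2 Q, ← h]
  have s2 : Φ ∘ₗ kronL A = kronL (φ₁ A) ∘ₗ φ₂ := by
    apply lin_ext_pure
    intro Q hQ
    exact LinearMap.congr_fun (s1 ⟨Q, hQ⟩) A
  exact LinearMap.congr_fun s2 B

theorem card_le_of_iso (U : Matrix ι' ι ℂ) (h : Uᴴ * U = 1) : Fintype.card ι ≤ Fintype.card ι' := by
  have h1 : (Uᴴ * U).rank ≤ U.rank := rank_mul_le_right _ _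
  rw [h, rank_one] at h1
  exact h1.trans (rank_le_card_height U)

/-- Complexification of a real-linear map between spaces of hermitian matrices. -/
theorem complexify (Ψ : selfAdjoint (Matrix ι ι ℂ) →ₗ[ℝ] selfAdjoint (Matrix κ κ ℂ)) :
    ∃ Φ : Matrix ι ι ℂ →ₗ[ℂ] Matrix κ κ ℂ, ∀ A : selfAdjoint (Matrix ι ι ℂ), Φ A.1 = (Ψ A).1 := by
  refine ⟨{ toFun := fun M => (Ψ (realPart M)).1 + Complex.I • (Ψ (imaginaryPart M)).1
            map_add' := fun x y => ?_
            map_smul' := fun c x => ?_ }, ?_⟩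
  · simp only [map_add, AddSubgroup.coe_add, smul_add]
    abel
  · simp only [realPart_smul, imaginaryPart_smul, map_add, map_sub, map_smul, AddSubgroup.coe_add, AddSubgroup.coe_sub, selfAdjoint.val_smul, RingHom.id_apply]
    ext i j
    simp
    apply Complex.ext <;> simp <;> ring
  · intro A
    have h1 : realPart A.1 = A := Subtype.ext (IsSelfAdjoint.coe_realPart A.2)
    have h2 : imaginaryPart A.1 = 0 := IsSelfAdjoint.imaginaryPart A.2
    simp [h1, h2]

/-- Maps of the standard form preserve pure states. -/
theorem form_pure (U : Matrix ι ι ℂ) (hU : U ∈ Matrix.unitaryGroup ι ℂ) (ψ : Matrix ι ι ℂ → Matrix ι ι ℂ)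
    (h : (∀ X, ψ X = U * X * Uᴴ) ∨ (∀ X, ψ X = U * Xᵀ * Uᴴ)) :
    (∀ P ∈ PureSet ι, ψ P ∈ PureSet ι) ∧ ∀ P ∈ PureSet ι, ∃ Q ∈ PureSet ι, ψ Q = P := by
  have u1 : Uᴴ * U = 1 := Matrix.mem_unitaryGroup_iff'.1 hU
  have u2 : U * Uᴴ = 1 := Matrix.mem_unitaryGroup_iff.1 hU
  have cj : ∀ W : Matrix ι ι ℂ, Wᴴ * W = 1 → ∀ P ∈ PureSet ι, W * P * Wᴴ ∈ PureSet ι := by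
    rintro W hW _ ⟨x, hx, rfl⟩
    refine ⟨W *ᵥ x, ?_, ?_⟩
    · rw [star_mulVec, ← dotProduct_mulVec, mulVec_mulVec, hW, one_mulVec, hx]
    · rw [mul_vecMulVec, vecMulVec_mul, star_mulVec]
  have cj2 : ∀ P ∈ PureSet ι, Uᴴ * P * U ∈ PureSet ι := by
    intro P hP
    simpa using cj Uᴴ (by simpa using u2) P hP
  have cc : ∀ P, U * (Uᴴ * P * U) * Uᴴ = P := by
    intro P
    calc _ = (U * Uᴴ) * P * (U * Uᴴ) := by noncomm_ring
      _ = P := by rw [u2]; simp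
  rcases h with h | h
  · refine ⟨fun P hP => ?_, fun P hP => ⟨_, cj2 P hP, ?_⟩⟩
    · rw [h]; exact cj U u1 P hP
    · rw [h, cc]
  · refine ⟨fun P hP => ?_, fun P hP => ⟨_, pure_transpose (cj2 P hP), ?_⟩⟩
    · rw [h]; exact cj U u1 _ (pure_transpose hP)
    · rw [h, transpose_transpose, cc]
end


theorem mem_pureProd_iff {m n : ℕ} (C : HermMat m n) :
    C ∈ PureProd m n ↔ C.1 ∈ PPSet (Fin m) (Fin n) := by
  constructor
  · rintro ⟨P, Q, hP, hQ, e⟩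
    exact ⟨P, isPureState_iff.1 hP, Q, isPureState_iff.1 hQ, e⟩
  · rintro ⟨P, hP, Q, hQ, e⟩
    exact ⟨P, Q, isPureState_iff.2 hP, isPureState_iff.2 hQ, e⟩

theorem ppset_lift {m n : ℕ} {C : Matrix (Fin m × Fin n) (Fin m × Fin n) ℂ}
    (h : C ∈ PPSet (Fin m) (Fin n)) : ∃ D ∈ PureProd m n, D.1 = C := by
  obtain ⟨P, hP, Q, hQ, rfl⟩ := h
  refine ⟨kronSA ⟨P, pure_herm hP⟩ ⟨Q, pure_herm hQ⟩, ?_, rfl⟩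
  rw [mem_pureProd_iff]
  exact ⟨P, hP, Q, hQ, rfl⟩

/-- Theorem 2.3 (bipartite case): an `ℝ`-linear map `Ψ` on `H_{mn}` satisfies
`Ψ(P_m ⊗ P_n) = P_m ⊗ P_n` if and only if, for some unitary `U ∈ M_m`, `V ∈ M_n`, either
(c.1) `Ψ(A ⊗ B) = ψ₁(A) ⊗ ψ₂(B)` for all Hermitian `A, B`, or (c.2) `m = n` and
`Ψ(A ⊗ B) = ψ₂(B) ⊗ ψ₁(A)` for all Hermitian `A, B`, where `ψ₁` is `A ↦ UAU*` or
`A ↦ UAᵀU*` and `ψ₂` is `B ↦ VBV*` or `B ↦ VBᵀV*`. -/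
theorem pure_product_preserver_form (m n : ℕ) (hm : 2 ≤ m) (hn : 2 ≤ n)
    (Ψ : HermMat m n →ₗ[ℝ] HermMat m n) :
    Ψ '' PureProd m n = PureProd m n ↔
      ∃ (U : Matrix (Fin m) (Fin m) ℂ) (V : Matrix (Fin n) (Fin n) ℂ)
        (ψ₁ : Matrix (Fin m) (Fin m) ℂ → Matrix (Fin m) (Fin m) ℂ)
        (ψ₂ : Matrix (Fin n) (Fin n) ℂ → Matrix (Fin n) (Fin n) ℂ),
        U ∈ Matrix.unitaryGroup (Fin m) ℂ ∧ V ∈ Matrix.unitaryGroup (Fin n) ℂ ∧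
        ((∀ X, ψ₁ X = U * X * Uᴴ) ∨ (∀ X, ψ₁ X = U * Xᵀ * Uᴴ)) ∧
        ((∀ X, ψ₂ X = V * X * Vᴴ) ∨ (∀ X, ψ₂ X = V * Xᵀ * Vᴴ)) ∧
        ((∀ (A : Herm m) (B : Herm n),
            (Ψ (kronSA A B) : Matrix (Fin m × Fin n) (Fin m × Fin n) ℂ) =
              ψ₁ (A : Matrix (Fin m) (Fin m) ℂ) ⊗ₖ ψ₂ (B : Matrix (Fin n) (Fin n) ℂ)) ∨
         (∃ h : m = n, ∀ (A : Herm m) (B : Herm n),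
            ∀ p q : Fin m × Fin n,
              (Ψ (kronSA A B) : Matrix (Fin m × Fin n) (Fin m × Fin n) ℂ) p q =
                ψ₂ (B : Matrix (Fin n) (Fin n) ℂ) (Fin.cast h p.1) (Fin.cast h q.1) *
                ψ₁ (A : Matrix (Fin m) (Fin m) ℂ) (Fin.cast h.symm p.2)
                  (Fin.cast h.symm q.2))) := by
  constructor
  · intro h
    obtain ⟨Φ, hΦ⟩ := complexify Ψ
    have hPP : Φ '' PPSet (Fin m) (Fin n) = PPSet (Fin m) (Fin n) := by
      apply Set.Subset.antisymm
      · rintro _ ⟨C, hC, rfl⟩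
        obtain ⟨D, hD, rfl⟩ := ppset_lift hC
        rw [hΦ, ← mem_pureProd_iff, ← h]
        exact ⟨D, hD, rfl⟩
      · intro C hC
        obtain ⟨D, hD, rfl⟩ := ppset_lift hC
        rw [← h] at hD
        obtain ⟨D', hD', rfl⟩ := hD
        exact ⟨D'.1, (mem_pureProd_iff D').1 hD', hΦ D'⟩
    haveI : Nontrivial (Fin m) := Fin.nontrivial_iff_two_le.2 hm
    haveI : Nontrivial (Fin n) := Fin.nontrivial_iff_two_le.2 hn
    rcases factor_pure Φ hPP with ⟨f, g, hf, hg, hfg⟩ | ⟨f, g, hf, hg, hfg⟩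
    · obtain ⟨U, V, ψ₁, ψ₂, hU, hV, h1, h2, h3⟩ := factor_linear Φ f g hf hg hfg
      refine ⟨U, V, ψ₁, ψ₂, Matrix.mem_unitaryGroup_iff'.2 hU, Matrix.mem_unitaryGroup_iff'.2 hV,
        h1, h2, Or.inl ?_⟩
      intro A B
      rw [← h3, ← hΦ]
      rfl
    · let S := (Matrix.reindexLinearEquiv ℂ ℂ (Equiv.prodComm (Fin m) (Fin n))
        (Equiv.prodComm (Fin m) (Fin n))).toLinearMap
      obtain ⟨U, V, ψ₁, ψ₂, hU, hV, h1, h2, h3⟩ := factor_linear (S ∘ₗ Φ) f g hf hg (by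
        intro P Q
        ext ⟨a, b⟩ ⟨c, d⟩
        show Φ (P.1 ⊗ₖ Q.1) (b, a) (d, c) = _
        rw [hfg]
        simp [mul_comm])
      have c1 := card_le_of_iso U hU
      have c2 := card_le_of_iso V hV
      rw [Fintype.card_fin, Fintype.card_fin] at c1 c2
      have hmn : m = n := le_antisymm c1 c2
      subst hmn
      refine ⟨U, V, ψ₁, ψ₂, Matrix.mem_unitaryGroup_iff'.2 hU, Matrix.mem_unitaryGroup_iff'.2 hV,
        h1, h2, Or.inr ⟨rfl, ?_⟩⟩
      rintro A B ⟨a, b⟩ ⟨c, d⟩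
      have := congrFun (congrFun (h3 A.1 B.1) (b, a)) (d, c)
      have e : (Ψ (kronSA A B)).1 (a, b) (c, d) = (S ∘ₗ Φ) (A.1 ⊗ₖ B.1) (b, a) (d, c) := by
        rw [← hΦ]
        rfl
      rw [e, this, Matrix.kroneckerMap_apply, mul_comm]
      rfl
  · rintro ⟨U, V, ψ₁, ψ₂, hU, hV, h1, h2, h3⟩
    obtain ⟨f1, s1⟩ := form_pure U hU ψ₁ h1
    obtain ⟨f2, s2⟩ := form_pure V hV ψ₂ h2
    rcases h3 with h3 | ⟨hmn, h3⟩
    · apply Set.Subset.antisymm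
      · rintro _ ⟨C, hC, rfl⟩
        rw [mem_pureProd_iff] at hC ⊢
        obtain ⟨P, hP, Q, hQ, e⟩ := hC
        have : C = kronSA ⟨P, pure_herm hP⟩ ⟨Q, pure_herm hQ⟩ := Subtype.ext e
        rw [this]
        exact ⟨_, f1 P hP, _, f2 Q hQ, h3 _ _⟩
      · intro C hC
        rw [mem_pureProd_iff] at hC
        obtain ⟨P, hP, Q, hQ, e⟩ := hC
        obtain ⟨P', hP', rfl⟩ := s1 P hP
        obtain ⟨Q', hQ', rfl⟩ := s2 Q hQ
        refine ⟨kronSA ⟨P', pure_herm hP'⟩ ⟨Q', pure_herm hQ'⟩, ?_, ?_⟩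
        · rw [mem_pureProd_iff]
          exact ⟨P', hP', Q', hQ', rfl⟩
        · exact Subtype.ext ((h3 _ _).trans e.symm)
    · subst hmn
      have h4 : ∀ (A : Herm m) (B : Herm m), (Ψ (kronSA A B)).1 = ψ₂ B.1 ⊗ₖ ψ₁ A.1 := by
        intro A B
        ext p q
        exact h3 A B p q
      apply Set.Subset.antisymm
      · rintro _ ⟨C, hC, rfl⟩
        rw [mem_pureProd_iff] at hC ⊢
        obtain ⟨P, hP, Q, hQ, e⟩ := hC
        have : C = kronSA ⟨P, pure_herm hP⟩ ⟨Q, pure_herm hQ⟩ := Subtype.ext e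
        rw [this]
        exact ⟨_, f2 Q hQ, _, f1 P hP, h4 _ _⟩
      · intro C hC
        rw [mem_pureProd_iff] at hC
        obtain ⟨P, hP, Q, hQ, e⟩ := hC
        obtain ⟨P', hP', rfl⟩ := s2 P hP
        obtain ⟨Q', hQ', rfl⟩ := s1 Q hQ
        refine ⟨kronSA ⟨Q', pure_herm hQ'⟩ ⟨P', pure_herm hP'⟩, ?_, ?_⟩
        · rw [mem_pureProd_iff]
          exact ⟨Q', hQ', P', hP', rfl⟩
        · exact Subtype.ext ((h4 _ _).trans e.symm)
end

section
/- Let m, n ≥ 2 and let Ψ : H_{mn} → H_{mn} be an ℝ-linear map on the space of mn×mn Hermitian matrices. Then Ψ maps the set of pure product states onto itself, i.e. Ψ(P_m ⊗ P_n) = P_m ⊗ P_n, if and only if Ψ maps the set of separable states onto itself, i.e. Ψ(S_{m,n}) = S_{m,n}. -/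
open Matrix Kronecker

/-- A pure state is idempotent. -/
lemma IsPureState.mul_self_eq {m : ℕ} {A : Matrix (Fin m) (Fin m) ℂ} (h : IsPureState A) :
    A * A = A := by
  obtain ⟨-, hr, ht⟩ := h
  rw [Matrix.rank] at hr
  obtain ⟨v, -, hv⟩ := finrank_eq_one_iff'.1 hr
  have hcol : ∀ j, ∃ c : ℂ, ∀ i, A i j = c * (v : Fin m → ℂ) i := by
    intro j
    obtain ⟨c, hc⟩ := hv ⟨A.mulVecLin (Pi.single j 1), LinearMap.mem_range_self _ _⟩
    refine ⟨c, fun i => ?_⟩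
    have h1 := congrFun (congrArg Subtype.val hc) i
    simp at h1
    exact h1.symm
  choose c hc using hcol
  have ht' : ∑ j, c j * (v : Fin m → ℂ) j = 1 := by
    rw [← ht, Matrix.trace]
    exact Finset.sum_congr rfl fun j _ => (hc j j).symm
  ext i k
  rw [Matrix.mul_apply, hc k i]
  calc ∑ j, A i j * A j k = ∑ j, (c j * (v : Fin m → ℂ) j) * (c k * (v : Fin m → ℂ) i) :=
        Finset.sum_congr rfl fun j _ => by rw [hc j i, hc k j]; ring
    _ = _ := by rw [← Finset.sum_mul, ht', one_mul]

/-- The linear functional `X ↦ Re tr (C X)`. -/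
noncomputable def trFun {m n : ℕ} (C : HermMat m n) : HermMat m n →ₗ[ℝ] ℝ where
  toFun X := (Matrix.trace (C.1 * X.1)).re
  map_add' X Y := by simp [mul_add]
  map_smul' r X := by simp

lemma trFun_self {m n : ℕ} {C : HermMat m n} (h : C ∈ PureProd m n) : trFun C C = 1 := by
  obtain ⟨P, Q, hP, hQ, hC⟩ := h
  change (Matrix.trace (C.1 * C.1)).re = 1
  rw [hC, ← Matrix.mul_kronecker_mul, hP.mul_self_eq, hQ.mul_self_eq, Matrix.trace_kronecker,
    hP.2.2, hQ.2.2]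
  simp

lemma trFun_pos {m n : ℕ} {X : HermMat m n} (h : X ≠ 0) : 0 < trFun X X := by
  have hX : (X.1)ᴴ = X.1 := X.2
  have h1 : trFun X X = ∑ i, ∑ j, ‖X.1 j i‖ ^ 2 := by
    change (Matrix.trace (X.1 * X.1)).re = _
    nth_rewrite 1 [← hX]
    rw [Matrix.trace, Complex.re_sum]
    refine Finset.sum_congr rfl fun i _ => ?_
    rw [Matrix.diag_apply, Matrix.mul_apply, Complex.re_sum]
    refine Finset.sum_congr rfl fun j _ => ?_
    rw [Matrix.conjTranspose_apply, ← Complex.normSq_eq_norm_sq]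
    simp [Complex.normSq_apply]
  rw [h1]
  obtain ⟨j, i, hij⟩ : ∃ j i, X.1 j i ≠ 0 := by
    by_contra! hc
    exact h (Subtype.ext (Matrix.ext hc))
  refine Finset.sum_pos' (fun _ _ => by positivity) ⟨i, Finset.mem_univ _, ?_⟩
  refine Finset.sum_pos' (fun _ _ => by positivity) ⟨j, Finset.mem_univ _, ?_⟩
  positivity

lemma trFun_lt {m n : ℕ} {C D : HermMat m n} (hC : C ∈ PureProd m n) (hD : D ∈ PureProd m n)
    (h : D ≠ C) : trFun C D < 1 := by
  have h0 := trFun_pos (sub_ne_zero.2 h)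
  have h1 : trFun (D - C) (D - C) = trFun D D - 2 * trFun C D + trFun C C := by
    change (Matrix.trace ((D.1 - C.1) * (D.1 - C.1))).re = (Matrix.trace (D.1 * D.1)).re
      - 2 * (Matrix.trace (C.1 * D.1)).re + (Matrix.trace (C.1 * C.1)).re
    have := Matrix.trace_mul_comm C.1 D.1
    simp only [sub_mul, mul_sub, Matrix.trace_sub, Complex.sub_re, this]
    ring
  rw [trFun_self hC, trFun_self hD] at h1
  linarith

/-- If every point of `A` is exposed, it is extreme in the convex hull. -/
lemma extreme_of_exposed {E : Type*} [AddCommGroup E] [Module ℝ E] {A : Set E} {p : E}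
    (f : E →ₗ[ℝ] ℝ) (hp : p ∈ A) (hfp : f p = 1) (hf : ∀ q ∈ A, q ≠ p → f q < 1) :
    p ∈ (convexHull ℝ A).extremePoints ℝ := by
  have key : convexHull ℝ A ⊆ {q | q = p ∨ f q < 1} := by
    apply convexHull_min
    · intro q hq
      by_cases h : q = p
      · exact Or.inl h
      · exact Or.inr (hf q hq h)
    · rw [convex_iff_forall_pos]
      rintro x hx y hy a b ha hb hab
      by_cases hxy : x = p ∧ y = p
      · left
        rw [hxy.1, hxy.2, ← add_smul, hab, one_smul]
      · right
        have hx' : f x ≤ 1 := by rcases hx with rfl | h <;> linarith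
        have hy' : f y ≤ 1 := by rcases hy with rfl | h <;> linarith
        simp only [map_add, map_smul, smul_eq_mul]
        rcases hx with hx | hx
        · rcases hy with hy | hy
          · exact absurd ⟨hx, hy⟩ hxy
          · nlinarith
        · nlinarith
  rw [mem_extremePoints_iff_left]
  refine ⟨subset_convexHull ℝ A hp, ?_⟩
  rintro x hx y hy ⟨a, b, ha, hb, hab, rfl⟩
  rcases key hx with h | h
  · exact h
  · exfalso
    have hy' : f y ≤ 1 := by rcases key hy with h | h <;> [rw [h, hfp]; exact h.le]
    simp only [map_add, map_smul, smul_eq_mul] at hfp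
    nlinarith

lemma image_eq_of_hull {E : Type*} [AddCommGroup E] [Module ℝ E] [FiniteDimensional ℝ E]
    {A : Set E} (hA : A ⊆ (convexHull ℝ A).extremePoints ℝ) (Ψ : E →ₗ[ℝ] E)
    (h : Ψ '' convexHull ℝ A = convexHull ℝ A) : Ψ '' A = A := by
  have hA' : (convexHull ℝ A).extremePoints ℝ = A :=
    Set.Subset.antisymm extremePoints_convexHull_subset hA
  set S := convexHull ℝ A with hS
  have hmap : (Submodule.span ℝ S).map Ψ = Submodule.span ℝ S := by
    rw [Submodule.map_span, h]
  have hmem : ∀ x ∈ Submodule.span ℝ S, Ψ x ∈ Submodule.span ℝ S := fun x hx => by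
    rw [← hmap]; exact Submodule.mem_map_of_mem hx
  have hsurj : Function.Surjective (Ψ.restrict hmem) := by
    rintro ⟨y, hy⟩
    rw [← hmap] at hy
    obtain ⟨x, hx, rfl⟩ := hy
    exact ⟨⟨x, hx⟩, rfl⟩
  have hinj := LinearMap.injective_iff_surjective.2 hsurj
  have inj : ∀ x ∈ S, ∀ y ∈ S, Ψ x = Ψ y → x = y := fun x hx y hy hxy => by
    have := @hinj ⟨x, Submodule.subset_span hx⟩ ⟨y, Submodule.subset_span hy⟩ (Subtype.ext hxy)
    exact congrArg Subtype.val this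
  have hconv : Convex ℝ S := convex_convexHull ℝ A
  have hΨ : ∀ x ∈ S, Ψ x ∈ S := fun x hx => h ▸ Set.mem_image_of_mem Ψ hx
  have iff : ∀ p ∈ S, p ∈ A ↔ Ψ p ∈ A := by
    intro p hp
    rw [← hA', mem_extremePoints_iff_left, mem_extremePoints_iff_left]
    constructor
    · rintro ⟨-, hpe⟩
      refine ⟨hΨ p hp, ?_⟩
      rintro x hx y hy ⟨a, b, ha, hb, hab, he⟩
      rw [← h] at hx hy
      obtain ⟨x, hx, rfl⟩ := hx
      obtain ⟨y, hy, rfl⟩ := hy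
      rw [hpe x hx y hy ⟨a, b, ha, hb, hab, ?_⟩]
      apply inj _ (hconv hx hy ha.le hb.le hab) _ hp
      simpa using he
    · rintro ⟨-, hpe⟩
      refine ⟨hp, ?_⟩
      rintro x hx y hy ⟨a, b, ha, hb, hab, he⟩
      apply inj x hx p hp
      refine hpe _ (hΨ x hx) _ (hΨ y hy) ⟨a, b, ha, hb, hab, ?_⟩
      rw [← he]
      simp
  have hAS : A ⊆ S := subset_convexHull ℝ A
  apply Set.Subset.antisymm
  · rintro _ ⟨p, hp, rfl⟩
    exact (iff p (hAS hp)).1 hp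
  · intro q hq
    have hq' := hAS hq
    rw [← h] at hq'
    obtain ⟨p, hp, rfl⟩ := hq'
    exact ⟨p, (iff p hp).2 hq, rfl⟩

/-- An `ℝ`-linear map `Ψ` on `H_{mn}` maps the pure product states onto themselves,
`Ψ(P_m ⊗ P_n) = P_m ⊗ P_n`, if and only if it maps the separable states
`S_{m,n} = conv(P_m ⊗ P_n)` onto themselves, `Ψ(S_{m,n}) = S_{m,n}`. -/
theorem pure_product_preserver_iff_sep_preserver (m n : ℕ) (hm : 2 ≤ m) (hn : 2 ≤ n)
    (Ψ : HermMat m n →ₗ[ℝ] HermMat m n) :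
    Ψ '' PureProd m n = PureProd m n ↔
      Ψ '' convexHull ℝ (PureProd m n) = convexHull ℝ (PureProd m n) := by
  constructor
  · intro h
    rw [Ψ.isLinear.image_convexHull, h]
  · intro h
    have : FiniteDimensional ℝ (HermMat m n) :=
      inferInstanceAs (FiniteDimensional ℝ
        (selfAdjoint.submodule ℝ (Matrix (Fin m × Fin n) (Fin m × Fin n) ℂ)))
    exact image_eq_of_hull (fun p hp => extreme_of_exposed (trFun p) hp (trFun_self hp)
      fun q hq hne => trFun_lt hp hq hne) Ψ h
end
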